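/- A multi-GGS-group G is just infinite and has the congruence subgroup property if and only if G is not the GGS-group 𝒢 defined by a constant vector. -/

import Mathlib

/-!
Automorphisms of the `p`-regular rooted tree, encoded by portraits:
an automorphism is a family of permutations of `Fin p`, one for each vertex
(vertices are finite words over `Fin p`, the root being `[]`).
-/

namespace TreeAut

variable {p : ℕ}

/-- Automorphisms of the `p`-regular rooted tree, given by their portraits. -/
def AutT (p : ℕ) : Type := List (Fin p) → Equiv.Perm (Fin p)

namespace AutT

/-- The action of a tree automorphism on the vertices (finite words over `Fin p`). -/
def act : AutT p → List (Fin p) → List (Fin p)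
  | _, [] => []
  | f, x :: w => f [] x :: act (fun v => f (x :: v)) w

/-- The section of `f` at the level-one vertex `x`; the map
`f ↦ (sections f 0, …, sections f (p-1))` restricted to the first-level
stabilizer is the isomorphism `ψ`. -/
def sections (f : AutT p) : Fin p → AutT p := fun x v => f (x :: v)

instance : One (AutT p) := ⟨fun _ => 1⟩

instance : Mul (AutT p) := ⟨fun f g v => f (act g v) * g v⟩

/-- The action of the inverse automorphism on vertices. -/
def invAct : AutT p → List (Fin p) → List (Fin p)
  | _, [] => []
  | f, x :: w => (f [])⁻¹ x :: invAct (fun v => f (((f [])⁻¹ x) :: v)) w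

instance : Inv (AutT p) := ⟨fun f v => (f (invAct f v))⁻¹⟩

lemma one_apply (v : List (Fin p)) : (1 : AutT p) v = 1 := rfl

lemma mul_apply (f g : AutT p) (v : List (Fin p)) : (f * g) v = f (act g v) * g v := rfl

lemma inv_apply (f : AutT p) (v : List (Fin p)) : f⁻¹ v = (f (invAct f v))⁻¹ := rfl

lemma act_nil (f : AutT p) : act f [] = [] := rfl

lemma act_cons (f : AutT p) (x : Fin p) (w : List (Fin p)) :
    act f (x :: w) = f [] x :: act (sections f x) w := rfl

lemma sections_mul (f g : AutT p) (x : Fin p) :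
    sections (f * g) x = sections f (g [] x) * sections g x :=
  funext fun _ => rfl

lemma act_one : ∀ v : List (Fin p), act (1 : AutT p) v = v
  | [] => rfl
  | x :: w => congrArg (x :: ·) (act_one w)

lemma act_mul (f g : AutT p) : ∀ v : List (Fin p), act (f * g) v = act f (act g v)
  | [] => rfl
  | x :: w => by
      rw [act_cons (f * g), sections_mul, act_mul, act_cons g, act_cons f]
      rfl

lemma invAct_act (f : AutT p) : ∀ v : List (Fin p), invAct f (act f v) = v
  | [] => rfl
  | x :: w => by
      rw [act_cons]
      show (f [])⁻¹ (f [] x) ::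
          invAct (fun v => f (((f [])⁻¹ (f [] x)) :: v)) (act (sections f x) w) = x :: w
      refine (congrArg (fun y => y :: invAct (fun v => f (y :: v)) (act (sections f x) w))
        (Equiv.symm_apply_apply (f []) x)).trans ?_
      exact congrArg (x :: ·) (invAct_act (sections f x) w)

instance : Group (AutT p) where
  mul_assoc f g h := by
    funext v
    show (f * g) (act h v) * h v = f (act (g * h) v) * (g * h) v
    rw [mul_apply, mul_apply, act_mul, mul_assoc]
  one_mul f := by
    funext v
    show (1 : AutT p) (act f v) * f v = f v
    rw [one_apply, one_mul]
  mul_one f := by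
    funext v
    show f (act (1 : AutT p) v) * (1 : AutT p) v = f v
    rw [act_one, one_apply, mul_one]
  inv_mul_cancel f := by
    funext v
    show f⁻¹ (act f v) * f v = (1 : AutT p) v
    rw [inv_apply, invAct_act, one_apply, inv_mul_cancel]

lemma act_length (f : AutT p) : ∀ v : List (Fin p), (act f v).length = v.length
  | [] => rfl
  | _ :: w => congrArg Nat.succ (act_length _ w)

lemma act_act_inv (f : AutT p) (v : List (Fin p)) : act f (act f⁻¹ v) = v := by
  rw [← act_mul, mul_inv_cancel, act_one]

/-- The pointwise stabilizer `st(n)` of the `n`-th level of the tree. -/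
def levelStab (p n : ℕ) : Subgroup (AutT p) where
  carrier := {f | ∀ v : List (Fin p), v.length = n → act f v = v}
  one_mem' := fun v _ => act_one v
  mul_mem' := by
    intro f g hf hg v hv
    rw [act_mul, hg v hv, hf v hv]
  inv_mem' := by
    intro f hf v hv
    have h1 : act f (act f⁻¹ v) = v := act_act_inv f v
    have h2 : act f (act f⁻¹ v) = act f⁻¹ v := hf _ (by rw [act_length, hv])
    exact h2.symm.trans h1

instance levelStab_normal (p n : ℕ) : (levelStab p n).Normal := by
  constructor
  intro f hf g v hv
  show act (g * f * g⁻¹) v = v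
  rw [act_mul, act_mul, hf _ (by rw [act_length, hv]), act_act_inv]

/-- The tuple of sections at the level-two vertices.  Restricted to the
second-level stabilizer this is the map `ψ₂`. -/
def sections2 (f : AutT p) : Fin p → Fin p → AutT p := fun x y v => f (x :: y :: v)

/-- The rooted automorphism defined by a permutation `σ` of `Fin p`. -/
def rooted (σ : Equiv.Perm (Fin p)) : AutT p := fun v => if v = [] then σ else 1

/-- The rooted automorphism `a`, acting at the root by the cycle `(1 2 … p)`. -/
def rootedA (p : ℕ) : AutT p := rooted (finRotate p)

/-- Auxiliary portrait for the directed automorphism `b_e`. -/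
def directedAux (e : Fin (p - 1) → ZMod p) : List (Fin p) → Equiv.Perm (Fin p)
  | [] => 1
  | x :: w =>
      if h : (x : ℕ) < p - 1 then
        (if w = [] then finRotate p ^ ((e ⟨x, h⟩).val) else 1)
      else directedAux e w

/-- The directed automorphism `b_e` defined by the vector `e ∈ 𝔽_p^{p-1}`,
i.e. the unique automorphism with `ψ(b_e) = (a^{e_1}, …, a^{e_{p-1}}, b_e)`. -/
def directed (e : Fin (p - 1) → ZMod p) : AutT p := directedAux e

/-- The multi-GGS-group determined by the vectors `e 1, …, e r`. -/
def multiGGS (p : ℕ) {r : ℕ} (e : Fin r → Fin (p - 1) → ZMod p) : Subgroup (AutT p) :=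
  Subgroup.closure ({rootedA p} ∪ Set.range fun i => directed (e i))

/-- The GGS-group `𝒢` defined by the (nonzero) constant vector `(c, …, c)`. -/
def constGGS (p : ℕ) (c : ZMod p) : Subgroup (AutT p) :=
  Subgroup.closure {rootedA p, directed (fun _ => c)}

/-- `G` is the GGS-group `𝒢` defined by a constant vector. -/
def IsConstGGS {p : ℕ} (G : Subgroup (AutT p)) : Prop :=
  ∃ c : ZMod p, c ≠ 0 ∧ G = constGGS p c

/-- The stabilizer `st_G(n) = G ∩ st(n)`, viewed as a subgroup of `G`. -/
def stabIn {p : ℕ} (G : Subgroup (AutT p)) (n : ℕ) : Subgroup G :=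
  (levelStab p n).comap G.subtype

instance {p : ℕ} (G : Subgroup (AutT p)) (n : ℕ) : (stabIn G n).Normal :=
  Subgroup.Normal.comap (levelStab_normal p n) G.subtype

/-- The congruence subgroup property: every finite-index subgroup of `G`
contains a level stabilizer `st_G(n)`. -/
def HasCSP {p : ℕ} (G : Subgroup (AutT p)) : Prop :=
  ∀ H : Subgroup G, H.FiniteIndex → ∃ n : ℕ, stabIn G n ≤ H

/-- `G` is just infinite: it is infinite and all its nontrivial normal
subgroups have finite index. -/
def JustInfinite {p : ℕ} (G : Subgroup (AutT p)) : Prop :=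
  Infinite G ∧ ∀ N : Subgroup G, N.Normal → N ≠ ⊥ → N.FiniteIndex

end AutT

end TreeAut

namespace TreeAut

namespace AutT

open scoped commutatorElement

section Portraits

variable {p : ℕ}

lemma ext_portrait {f g : AutT p} (h : f [] = g []) (hs : ∀ x, sections f x = sections g x) :
    f = g := by
  funext v
  cases v with
  | nil => exact h
  | cons x w => exact congrFun (hs x) w

lemma root_mul (f g : AutT p) : (f * g) [] = f [] * g [] := rfl

lemma root_one : (1 : AutT p) [] = 1 := rfl

lemma sections_one (x : Fin p) : sections (1 : AutT p) x = 1 := rfl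

/-- The permutation of the first level induced by an automorphism. -/
def rootHom (p : ℕ) : AutT p →* Equiv.Perm (Fin p) where
  toFun f := f []
  map_one' := rfl
  map_mul' _ _ := rfl

lemma root_inv (f : AutT p) : f⁻¹ [] = (f [])⁻¹ := map_inv (rootHom p) f

/-- Sections at `x`, as a homomorphism on the first-level stabilizer. -/
def sectionHom (x : Fin p) : (rootHom p).ker →* AutT p where
  toFun f := sections f.1 x
  map_one' := rfl
  map_mul' f g := by
    have hg : g.1 [] = 1 := g.2
    show sections (f.1 * g.1) x = _
    rw [sections_mul, hg]
    rfl

lemma sections_mul_of_root {f g : AutT p} (hg : g [] = 1) (x : Fin p) :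
    sections (f * g) x = sections f x * sections g x := by
  rw [sections_mul, hg]
  rfl

lemma sections_commutator_of_root {f g : AutT p} (hf : f [] = 1) (hg : g [] = 1) (x : Fin p) :
    sections ⁅f, g⁆ x = ⁅sections f x, sections g x⁆ :=
  map_commutatorElement (sectionHom x) (⟨f, hf⟩ : (rootHom p).ker) ⟨g, hg⟩

lemma root_commutator_of_root {f : AutT p} (hf : f [] = 1) (g : AutT p) :
    ⁅f, g⁆ [] = 1 := by
  have h := map_commutatorElement (rootHom p) f g
  have hf' : rootHom p f = 1 := hf
  rw [hf', commutatorElement_one_left] at h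
  exact h

lemma mem_levelStab_succ {n : ℕ} {f : AutT p} [NeZero p] :
    f ∈ levelStab p (n + 1) ↔ f [] = 1 ∧ ∀ x, sections f x ∈ levelStab p n := by
  constructor
  · intro hf
    have key : ∀ (x : Fin p) (w : List (Fin p)), w.length = n →
        f [] x = x ∧ act (sections f x) w = w := by
      intro x w hw
      have h := hf (x :: w) (by simp [hw])
      rw [act_cons] at h
      exact List.cons_eq_cons.mp h
    exact ⟨Equiv.ext fun x => (key x (List.replicate n x) (by simp)).1,
      fun x w hw => (key x w hw).2⟩
  · rintro ⟨h1, h2⟩ v hv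
    cases v with
    | nil => simp at hv
    | cons x w =>
      rw [act_cons, h1, h2 x w (by simpa using hv)]
      rfl

/-- The portrait which is `h` below the level-one vertex `x`, and trivial elsewhere. -/
def graftPortrait (x : Fin p) (h : AutT p) : AutT p
  | [] => 1
  | y :: w => if y = x then h w else 1

lemma sections_graftPortrait (x y : Fin p) (h : AutT p) :
    sections (graftPortrait x h) y = if y = x then h else 1 := by
  funext w
  show (if y = x then h w else 1) = _
  split_ifs <;> rfl

/-- The automorphism acting as `h` on the subtree below the level-one vertex `x`,
and trivially elsewhere. -/
def graft (x : Fin p) : AutT p →* AutT p where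
  toFun := graftPortrait x
  map_one' := ext_portrait rfl fun y => by
    rw [sections_graftPortrait, ite_self, sections_one]
  map_mul' f g := ext_portrait rfl fun y => by
    rw [sections_mul_of_root rfl, sections_graftPortrait, sections_graftPortrait,
      sections_graftPortrait]
    split_ifs <;> simp

lemma graft_root (x : Fin p) (h : AutT p) : graft x h [] = 1 := rfl

lemma sections_graft (x y : Fin p) (h : AutT p) :
    sections (graft x h) y = if y = x then h else 1 :=
  sections_graftPortrait x y h

lemma graft_conj (g h : AutT p) (x : Fin p) :
    g * graft x h * g⁻¹ = graft (g [] x) (sections g x * h * (sections g x)⁻¹) := by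
  rw [mul_inv_eq_iff_eq_mul]
  refine ext_portrait ?_ fun y => ?_
  · rw [root_mul, root_mul, graft_root, graft_root, mul_one, one_mul]
  · rw [sections_mul, sections_mul, graft_root, sections_graft, sections_graft]
    by_cases hy : y = x
    · subst hy
      simp
    · simp [hy]

lemma graft_commutator {q : AutT p} (hq : q [] = 1) (x : Fin p) (h : AutT p) :
    ⁅graft x h, q⁆ = graft x ⁅h, sections q x⁆ := by
  refine ext_portrait (root_commutator_of_root rfl q) fun y => ?_
  rw [sections_commutator_of_root rfl hq, sections_graft, sections_graft]
  by_cases hy : y = x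
  · simp [hy]
  · simp [hy]

lemma commute_graft {x y : Fin p} (hxy : x ≠ y) (f g : AutT p) :
    Commute (graft x f) (graft y g) := by
  rw [← commutatorElement_eq_one_iff_commute, graft_commutator (graft_root y g),
    sections_graft, if_neg hxy, commutatorElement_one_right, map_one]

/-- An automorphism in the first-level stabilizer is the product of its grafted sections. -/
lemma mem_of_graft_sections_mem {M : Subgroup (AutT p)} {f : AutT p} (hf : f [] = 1)
    (h : ∀ x, graft x (sections f x) ∈ M) : f ∈ M := by
  have key : ∀ l : List (Fin p), l.Nodup →
      (l.map fun x => graft x (sections f x)).prod [] = 1 ∧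
      ∀ y, sections (l.map fun x => graft x (sections f x)).prod y =
        if y ∈ l then sections f y else 1 := by
    intro l hl
    induction l with
    | nil => exact ⟨rfl, fun y => by simp [sections_one]⟩
    | cons x l ih =>
      obtain ⟨hx, hl⟩ := List.nodup_cons.mp hl
      obtain ⟨ih1, ih2⟩ := ih hl
      refine ⟨by rw [List.map_cons, List.prod_cons, root_mul, ih1, graft_root, mul_one],
        fun y => ?_⟩
      rw [List.map_cons, List.prod_cons, sections_mul_of_root ih1, ih2, sections_graft]
      by_cases hy : y = x
      · subst hy
        simp [hx]
      · simp [hy]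
  obtain ⟨h1, h2⟩ := key _ (List.nodup_finRange p)
  have : f = ((List.finRange p).map fun x => graft x (sections f x)).prod :=
    ext_portrait (by rw [h1, hf]) fun y => by rw [h2, if_pos (List.mem_finRange y)]
  rw [this]
  refine list_prod_mem fun g hg => ?_
  obtain ⟨x, -, rfl⟩ := List.mem_map.mp hg
  exact h x

/-- The automorphism acting as `h` on the subtree below the vertex `u`,
and trivially elsewhere. -/
def graftWord : List (Fin p) → AutT p →* AutT p
  | [] => MonoidHom.id _
  | x :: u => (graft x).comp (graftWord u)

lemma graftWord_cons (x : Fin p) (u : List (Fin p)) (h : AutT p) :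
    graftWord (x :: u) h = graft x (graftWord u h) := rfl

lemma graftWord_append (u v : List (Fin p)) (h : AutT p) :
    graftWord (u ++ v) h = graftWord u (graftWord v h) := by
  induction u with
  | nil => rfl
  | cons x u ih => rw [List.cons_append, graftWord_cons, graftWord_cons, ih]

lemma commute_graftWord : ∀ {u v : List (Fin p)}, u.length = v.length → u ≠ v →
    ∀ f g : AutT p, Commute (graftWord u f) (graftWord v g)
  | [], [], _, h, _, _ => absurd rfl h
  | [], _ :: _, h, _, _, _ => by simp at h
  | _ :: _, [], h, _, _, _ => by simp at h
  | x :: u, y :: v, hl, hne, f, g => by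
    rw [graftWord_cons, graftWord_cons]
    by_cases hxy : x = y
    · subst hxy
      exact (commute_graftWord (by simpa using hl) (by simpa using hne) f g).map (graft x)
    · exact commute_graft hxy _ _

/-- A subgroup of tree automorphisms is self-similar when it contains the sections
of its elements. -/
def SelfSimilar (G : Subgroup (AutT p)) : Prop :=
  ∀ g ∈ G, ∀ x, sections g x ∈ G

lemma SelfSimilar.graftWord_conj {G : Subgroup (AutT p)} (hG : SelfSimilar G) :
    ∀ (u : List (Fin p)) {g : AutT p}, g ∈ G → ∃ s ∈ G, ∀ h : AutT p,
      g * graftWord u h * g⁻¹ = graftWord (act g u) (s * h * s⁻¹)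
  | [], g, hg => ⟨g, hg, fun _ => rfl⟩
  | x :: u, g, hg => by
    obtain ⟨s, hs, h⟩ := hG.graftWord_conj u (hG g hg x)
    refine ⟨s, hs, fun k => ?_⟩
    rw [graftWord_cons, graft_conj, h, act_cons, graftWord_cons]

lemma exists_act_ne {g : AutT p} (hg : g ≠ 1) : ∃ u : List (Fin p), act g u ≠ u := by
  by_contra! h
  have key : ∀ (v : List (Fin p)) (f : AutT p), (∀ u, act f u = u) → f v = 1 := by
    intro v
    induction v with
    | nil =>
      intro f hf
      ext1 x
      have := hf [x]
      rw [act_cons] at this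
      exact (List.cons_eq_cons.mp this).1
    | cons x v ih =>
      intro f hf
      refine ih (sections f x) fun u => ?_
      have := hf (x :: u)
      rw [act_cons] at this
      exact (List.cons_eq_cons.mp this).2
  exact hg (funext fun v => key v g h)

instance levelStab_finiteIndex (p n : ℕ) : (levelStab p n).FiniteIndex := by
  let φ : AutT p →* Equiv.Perm (List.Vector (Fin p) n) :=
    { toFun f :=
        { toFun v := ⟨act f v.1, (act_length f v.1).trans v.2⟩
          invFun v := ⟨act f⁻¹ v.1, (act_length f⁻¹ v.1).trans v.2⟩
          left_inv v := Subtype.ext (by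
            show act f⁻¹ (act f v.1) = v.1
            rw [← act_mul, inv_mul_cancel, act_one])
          right_inv v := Subtype.ext (act_act_inv f v.1) }
      map_one' := Equiv.ext fun v => Subtype.ext (act_one v.1)
      map_mul' f g := Equiv.ext fun v => Subtype.ext (act_mul f g v.1) }
  have h : φ.ker ≤ levelStab p n := by
    intro f hf v hv
    have := congrArg (fun σ => (σ ⟨v, hv⟩ : List.Vector (Fin p) n).1) (MonoidHom.mem_ker.mp hf)
    exact this
  exact Subgroup.finiteIndex_of_le h

lemma sections_rooted (σ : Equiv.Perm (Fin p)) (x : Fin p) : sections (rooted σ) x = 1 :=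
  funext fun w => if_neg (t := σ) (List.cons_ne_nil x w)

lemma directed_root (e : Fin (p - 1) → ZMod p) : directed e [] = 1 := rfl

end Portraits

section Generators

variable {p : ℕ} [Fact p.Prime]

/-- The level-one vertices, indexed by `ZMod p` in such a way that the directed automorphisms
are recursive at the vertex of index `0`. -/
def vtx : ZMod p ≃ Fin p where
  toFun c := ⟨(c - 1).val, ZMod.val_lt _⟩
  invFun x := ((x : ℕ) : ZMod p) + 1
  left_inv c := by simp
  right_inv x := by
    ext
    simp [ZMod.val_natCast, Nat.mod_eq_of_lt x.2]

/-- The translation of the level-one vertices by `k`. -/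
def rot (k : ZMod p) : Equiv.Perm (Fin p) := vtx.permCongr (Equiv.addRight k)

lemma rot_vtx (k c : ZMod p) : rot k (vtx c) = vtx (c + k) := by
  simp [rot, Equiv.permCongr_apply]

lemma rot_add (k l : ZMod p) : rot (k + l) = rot k * rot l := by
  ext1 x
  obtain ⟨c, rfl⟩ := vtx.surjective x
  rw [Equiv.Perm.mul_apply, rot_vtx, rot_vtx, rot_vtx]
  congr 1
  ring

lemma rot_injective : Function.Injective (rot : ZMod p → Equiv.Perm (Fin p)) := by
  intro k l h
  have := congrArg (fun σ => σ (vtx 0)) h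
  simpa [rot_vtx] using this

lemma rot_zero : rot (0 : ZMod p) = 1 := by
  ext1 x
  obtain ⟨c, rfl⟩ := vtx.surjective x
  rw [rot_vtx, add_zero]
  rfl

lemma rot_eq_one_iff {k : ZMod p} : rot k = 1 ↔ k = 0 := by
  rw [← rot_zero, rot_injective.eq_iff]

lemma finRotate_eq_rot : finRotate p = rot 1 := by
  ext1 x
  obtain ⟨c, rfl⟩ := vtx.surjective x
  rw [rot_vtx, finRotate_apply]
  have hp : 1 < p := (Fact.out : p.Prime).one_lt
  ext
  have : Fact (1 < p) := ⟨hp⟩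
  have h : (vtx (c + 1)).1 = (c - 1 + 1).val := by
    show (c + 1 - 1).val = _
    congr 1
    ring
  rw [h, ZMod.val_add, ZMod.val_one, Fin.val_add]
  congr 2
  rw [Fin.val_one', Nat.mod_eq_of_lt hp]

lemma finRotate_pow (n : ℕ) : finRotate p ^ n = rot (n : ZMod p) := by
  induction n with
  | zero => rw [pow_zero, Nat.cast_zero, rot_zero]
  | succ n ih => rw [pow_succ, ih, finRotate_eq_rot, Nat.cast_succ, rot_add]

/-- The power `a ^ k` of the rooted automorphism `a`. -/
def rotA (k : ZMod p) : AutT p := rooted (rot k)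

lemma rotA_root (k : ZMod p) : rotA k [] = rot k := rfl

lemma sections_rotA (k : ZMod p) (x : Fin p) : sections (rotA k) x = 1 := sections_rooted _ _

lemma rotA_add (k l : ZMod p) : rotA (k + l) = rotA k * rotA l := by
  refine ext_portrait ?_ fun x => ?_
  · rw [root_mul, rotA_root, rotA_root, rotA_root, rot_add]
  · rw [sections_mul, sections_rotA, sections_rotA, sections_rotA, mul_one]

lemma rotA_zero : rotA (0 : ZMod p) = 1 :=
  ext_portrait (by rw [rotA_root, rot_zero, root_one])
    fun x => by rw [sections_rotA, sections_one]

lemma rotA_neg (k : ZMod p) : rotA (-k) = (rotA k)⁻¹ := by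
  rw [eq_inv_iff_mul_eq_one, ← rotA_add, neg_add_cancel, rotA_zero]

lemma rotA_one : rotA (1 : ZMod p) = rootedA p := by
  rw [rotA, ← finRotate_eq_rot, rootedA]

lemma rotA_commute (k l : ZMod p) : Commute (rotA k) (rotA l) := by
  rw [Commute, SemiconjBy, ← rotA_add, ← rotA_add, add_comm]

/-- The entry of a defining vector at the level-one vertex of index `c`; the entry at the
index `0`, which the vector does not have, is `0`. -/
def coef : (Fin (p - 1) → ZMod p) →ₗ[ZMod p] (ZMod p → ZMod p) where
  toFun e c := if h : (vtx c : ℕ) < p - 1 then e ⟨vtx c, h⟩ else 0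
  map_add' e f := by
    funext c
    simp only [Pi.add_apply]
    split_ifs <;> simp
  map_smul' k e := by
    funext c
    simp only [Pi.smul_apply]
    split_ifs <;> simp

lemma vtx_lt_iff {c : ZMod p} : (vtx c : ℕ) < p - 1 ↔ c ≠ 0 := by
  have hp : 1 < p := (Fact.out : p.Prime).one_lt
  have h0 : ((vtx (0 : ZMod p) : Fin p) : ℕ) = p - 1 := by
    show ((0 : ZMod p) - 1).val = _
    rw [zero_sub]
    obtain ⟨n, rfl⟩ : ∃ n, p = n + 1 := ⟨p - 1, by omega⟩
    rw [ZMod.val_neg_one, Nat.add_sub_cancel]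
  constructor
  · rintro h rfl
    omega
  · intro hc
    have h1 : (vtx c : ℕ) ≠ p - 1 := fun h => hc (vtx.injective (Fin.ext (h.trans h0.symm)))
    have := (vtx c).2
    omega

lemma coef_zero (e : Fin (p - 1) → ZMod p) : coef e 0 = 0 :=
  dif_neg fun h => vtx_lt_iff.mp h rfl

lemma coef_of_lt (e : Fin (p - 1) → ZMod p) {c : ZMod p} (h : (vtx c : ℕ) < p - 1) :
    coef e c = e ⟨vtx c, h⟩ := dif_pos h

lemma exists_coef_eq (x : Fin (p - 1)) :
    ∃ c : ZMod p, c ≠ 0 ∧ ∀ e : Fin (p - 1) → ZMod p, coef e c = e x := by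
  have hx : (x : ℕ) < p := by omega
  obtain ⟨c, hc⟩ := vtx.surjective (⟨x, hx⟩ : Fin p)
  have hlt : (vtx c : ℕ) < p - 1 := by rw [hc]; exact x.2
  refine ⟨c, vtx_lt_iff.mp hlt, fun e => ?_⟩
  rw [coef_of_lt e hlt]
  congr 1
  ext
  simp [hc]

lemma coef_injective : Function.Injective (coef (p := p)) := by
  intro e f h
  funext x
  obtain ⟨c, -, hc⟩ := exists_coef_eq x
  rw [← hc e, ← hc f, h]

lemma coef_const (k : ZMod p) {c : ZMod p} (hc : c ≠ 0) :
    coef (fun _ : Fin (p - 1) => k) c = k :=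
  coef_of_lt _ (vtx_lt_iff.mpr hc)

lemma sections_directed (e : Fin (p - 1) → ZMod p) (c : ZMod p) :
    sections (directed e) (vtx c) = if c = 0 then directed e else rotA (coef e c) := by
  funext w
  show directedAux e (vtx c :: w) = _
  rw [directedAux]
  by_cases hc : c = 0
  · rw [dif_neg (fun h => vtx_lt_iff.mp h hc), if_pos hc]
    rfl
  · have h := vtx_lt_iff.mpr hc
    rw [dif_pos h, if_neg hc, coef_of_lt e h, finRotate_pow, ZMod.natCast_zmod_val]
    rfl

lemma directed_add (e f : Fin (p - 1) → ZMod p) :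
    directed (e + f) = directed e * directed f := by
  funext v
  induction v with
  | nil => rfl
  | cons x w ih =>
    obtain ⟨c, rfl⟩ := vtx.surjective x
    show sections (directed (e + f)) (vtx c) w = sections (directed e * directed f) (vtx c) w
    rw [sections_mul_of_root (directed_root f), sections_directed, sections_directed,
      sections_directed]
    by_cases hc : c = 0
    · simpa [hc] using ih
    · simp [hc, rotA_add]

lemma directed_eq_one {e : Fin (p - 1) → ZMod p} (h : directed e = 1) : e = 0 := by
  apply coef_injective
  rw [map_zero]
  funext c
  by_cases hc : c = 0
  · rw [hc, coef_zero]
    rfl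
  · have h1 := sections_directed e c
    rw [h, sections_one, if_neg hc] at h1
    have h2 := congrArg (rootHom p) h1
    rw [map_one] at h2
    exact rot_eq_one_iff.mp h2.symm

end Generators

section Words

variable {p : ℕ} {V Q : Type*} [AddCommGroup V] [Group Q]

/-- A group with a marked image of the free product of `ZMod p` and `V`. -/
structure Marking (p : ℕ) (V Q : Type*) [AddCommGroup V] [Group Q] where
  /-- the images of the elements of `ZMod p` -/
  α : ZMod p → Q
  /-- the images of the elements of `V` -/
  β : V → Q
  α_add : ∀ x y, α (x + y) = α x * α y
  β_add : ∀ v w, β (v + w) = β v * β w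

namespace Marking

variable (D : Marking p V Q)

lemma α_zero : D.α 0 = 1 := by
  have h := D.α_add 0 0
  rw [add_zero] at h
  exact left_eq_mul.mp h

lemma β_zero : D.β 0 = 1 := by
  have h := D.β_add 0 0
  rw [add_zero] at h
  exact left_eq_mul.mp h

lemma α_neg (x : ZMod p) : D.α (-x) = (D.α x)⁻¹ := by
  rw [eq_inv_iff_mul_eq_one, ← D.α_add, neg_add_cancel, α_zero]

lemma α_nsmul (n : ℕ) (x : ZMod p) : D.α (n • x) = D.α x ^ n := by
  induction n with
  | zero => rw [zero_nsmul, pow_zero, α_zero]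
  | succ n ih => rw [succ_nsmul, D.α_add, ih, pow_succ]

lemma β_nsmul (n : ℕ) (v : V) : D.β (n • v) = D.β v ^ n := by
  induction n with
  | zero => rw [zero_nsmul, pow_zero, β_zero]
  | succ n ih => rw [succ_nsmul, D.β_add, ih, pow_succ]

lemma α_smul_mem [NeZero p] {K : Subgroup Q} {x : ZMod p} (h : D.α x ∈ K) (c : ZMod p) :
    D.α (c * x) ∈ K := by
  rw [← ZMod.natCast_zmod_val c, ← nsmul_eq_mul, α_nsmul]
  exact pow_mem h _

lemma β_smul_mem [NeZero p] [Module (ZMod p) V] {K : Subgroup Q} {v : V} (h : D.β v ∈ K)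
    (c : ZMod p) : D.β (c • v) ∈ K := by
  rw [← ZMod.natCast_zmod_val c, Nat.cast_smul_eq_nsmul, β_nsmul]
  exact pow_mem h _

/-- The conjugate of `β v` by `α x`. -/
def letter (x : ZMod p) (v : V) : Q := D.α x * D.β v * (D.α x)⁻¹

lemma letter_add (x : ZMod p) (v w : V) : D.letter x (v + w) = D.letter x v * D.letter x w := by
  simp [letter, D.β_add]

lemma letter_zero (x : ZMod p) : D.letter x 0 = 1 := by
  simp [letter, D.β_zero]

lemma letter_neg (x : ZMod p) (v : V) : D.letter x (-v) = (D.letter x v)⁻¹ := by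
  rw [eq_inv_iff_mul_eq_one, ← D.letter_add, neg_add_cancel, letter_zero]

lemma letter_zero_left (v : V) : D.letter 0 v = D.β v := by
  simp [letter, D.α_zero]

lemma conj_letter (k x : ZMod p) (v : V) :
    D.α k * D.letter x v * (D.α k)⁻¹ = D.letter (x + k) v := by
  rw [letter, letter, add_comm x k, D.α_add]
  group

/-- The value of a word in the letters. -/
def ev : List (ZMod p × V) → Q
  | [] => 1
  | q :: l => D.letter q.1 q.2 * ev l

/-- The word whose letters have been conjugated by `α k`. -/
def shift (k : ZMod p) (l : List (ZMod p × V)) : List (ZMod p × V) :=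
  l.map fun q => (q.1 + k, q.2)

lemma ev_nil : D.ev [] = 1 := rfl

lemma ev_cons (q : ZMod p × V) (l : List (ZMod p × V)) :
    D.ev (q :: l) = D.letter q.1 q.2 * D.ev l := rfl

lemma ev_append (l m : List (ZMod p × V)) : D.ev (l ++ m) = D.ev l * D.ev m := by
  induction l with
  | nil => rw [List.nil_append, ev_nil, one_mul]
  | cons q l ih => rw [List.cons_append, ev_cons, ev_cons, ih, mul_assoc]

lemma ev_shift (k : ZMod p) (l : List (ZMod p × V)) :
    D.ev (shift k l) = D.α k * D.ev l * (D.α k)⁻¹ := by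
  induction l with
  | nil => simp [shift, ev_nil]
  | cons q l ih =>
    show D.letter (q.1 + k) q.2 * D.ev (shift k l) = _
    rw [ih, ev_cons, ← conj_letter]
    group

lemma ev_of_forall_fst_eq {x : ZMod p} {l : List (ZMod p × V)} (hx : ∀ q ∈ l, q.1 = x) :
    D.ev l = D.letter x (l.map Prod.snd).sum := by
  induction l with
  | nil => rw [ev_nil, List.map_nil, List.sum_nil, letter_zero]
  | cons q l ih =>
    rw [ev_cons, ih fun q hq => hx q (List.mem_cons_of_mem _ hq), List.map_cons,
      List.sum_cons, letter_add, hx q List.mem_cons_self]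

lemma exists_ev_inv (l : List (ZMod p × V)) : ∃ m, D.ev m = (D.ev l)⁻¹ := by
  induction l with
  | nil => exact ⟨[], by rw [ev_nil, inv_one]⟩
  | cons q l ih =>
    obtain ⟨m, hm⟩ := ih
    refine ⟨m ++ [(q.1, -q.2)], ?_⟩
    rw [ev_append, hm, ev_cons, ev_cons, ev_nil, mul_one, letter_neg, mul_inv_rev]

/-- The subgroup generated by the marked elements. -/
def gen : Subgroup Q := Subgroup.closure (Set.range D.α ∪ Set.range D.β)

lemma α_mem (x : ZMod p) : D.α x ∈ D.gen := Subgroup.subset_closure (Or.inl ⟨x, rfl⟩)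

lemma β_mem (v : V) : D.β v ∈ D.gen := Subgroup.subset_closure (Or.inr ⟨v, rfl⟩)

lemma letter_mem (x : ZMod p) (v : V) : D.letter x v ∈ D.gen :=
  mul_mem (mul_mem (D.α_mem x) (D.β_mem v)) (inv_mem (D.α_mem x))

lemma ev_mem (l : List (ZMod p × V)) : D.ev l ∈ D.gen := by
  induction l with
  | nil => exact one_mem _
  | cons q l ih => exact mul_mem (D.letter_mem _ _) ih

lemma mem_gen_iff {g : Q} : g ∈ D.gen ↔ ∃ l k, g = D.ev l * D.α k := by
  constructor
  · intro hg
    refine Subgroup.closure_induction (p := fun g _ => ∃ l k, g = D.ev l * D.α k)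
      ?_ ?_ ?_ ?_ hg
    · rintro _ (⟨x, rfl⟩ | ⟨v, rfl⟩)
      · exact ⟨[], x, by rw [ev_nil, one_mul]⟩
      · exact ⟨[(0, v)], 0, by
          rw [ev_cons, ev_nil, α_zero, mul_one, mul_one, letter_zero_left]⟩
    · exact ⟨[], 0, by rw [ev_nil, α_zero, mul_one]⟩
    · rintro _ _ _ _ ⟨l, k, rfl⟩ ⟨m, j, rfl⟩
      refine ⟨l ++ shift k m, k + j, ?_⟩
      rw [ev_append, ev_shift, D.α_add]
      group
    · rintro _ _ ⟨l, k, rfl⟩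
      obtain ⟨m, hm⟩ := D.exists_ev_inv l
      refine ⟨shift (-k) m, -k, ?_⟩
      rw [ev_shift, hm, α_neg]
      group
  · rintro ⟨l, k, rfl⟩
    exact mul_mem (D.ev_mem l) (D.α_mem k)

/-- The marking of a direct product given by two markings. -/
def prod {Q' : Type*} [Group Q'] (D : Marking p V Q) (D' : Marking p V Q') :
    Marking p V (Q × Q') where
  α x := (D.α x, D'.α x)
  β v := (D.β v, D'.β v)
  α_add x y := by rw [D.α_add, D'.α_add]; rfl
  β_add x y := by rw [D.β_add, D'.β_add]; rfl

lemma ev_prod {Q' : Type*} [Group Q'] (D : Marking p V Q) (D' : Marking p V Q')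
    (l : List (ZMod p × V)) : (D.prod D').ev l = (D.ev l, D'.ev l) := by
  induction l with
  | nil => rfl
  | cons q l ih => rw [ev_cons, ih]; rfl

variable [Fact p.Prime] [Module (ZMod p) V] (ε : V →ₗ[ZMod p] (Fin (p - 1) → ZMod p))

/-- The value of the word of the section at the index `c`. -/
def secVal (c : ZMod p) : List (ZMod p × V) → Q
  | [] => 1
  | q :: l => (if q.1 = c then D.β q.2 else D.α (coef (ε q.2) (c - q.1))) * secVal c l

/-- The normal form of the word of the section at the index `c`. -/
def secWord (c : ZMod p) : List (ZMod p × V) → List (ZMod p × V) × ZMod p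
  | [] => ([], 0)
  | q :: l =>
    if q.1 = c then ((0, q.2) :: (secWord c l).1, (secWord c l).2)
    else (shift (coef (ε q.2) (c - q.1)) (secWord c l).1,
      coef (ε q.2) (c - q.1) + (secWord c l).2)

lemma secVal_eq (c : ZMod p) (l : List (ZMod p × V)) :
    D.secVal ε c l = D.ev (secWord ε c l).1 * D.α (secWord ε c l).2 := by
  induction l with
  | nil => simp [secVal, secWord, ev_nil, α_zero]
  | cons q l ih =>
    rw [secVal, secWord, ih]
    split_ifs with h
    · rw [ev_cons, letter_zero_left, mul_assoc]
    · rw [ev_shift, D.α_add]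
      group

lemma length_secWord (c : ZMod p) (l : List (ZMod p × V)) :
    (secWord ε c l).1.length = l.countP fun q => q.1 = c := by
  induction l with
  | nil => rfl
  | cons q l ih =>
    rw [secWord]
    split_ifs with h
    · simp [h, ih]
    · simp [h, ih, shift]

end Marking

variable [Fact p.Prime] [Module (ZMod p) V]

/-- The marking of the multi-GGS-group with the space `V` of defining vectors. -/
def ggsMarking (ε : V →ₗ[ZMod p] (Fin (p - 1) → ZMod p)) : Marking p V (AutT p) where
  α := rotA
  β v := directed (ε v)
  α_add := rotA_add
  β_add v w := by rw [map_add, directed_add]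

/-- The multi-GGS-group with the space `V` of defining vectors. -/
def GGS (ε : V →ₗ[ZMod p] (Fin (p - 1) → ZMod p)) : Subgroup (AutT p) := (ggsMarking ε).gen

open Marking

variable (ε : V →ₗ[ZMod p] (Fin (p - 1) → ZMod p))

lemma ggs_letter_root (x : ZMod p) (v : V) : (ggsMarking ε).letter x v [] = 1 := by
  show (rotA x * directed (ε v) * (rotA x)⁻¹) [] = 1
  rw [root_mul, root_mul, directed_root, mul_one, root_inv, mul_inv_cancel]

lemma sections_ggs_letter (x c : ZMod p) (v : V) :
    sections ((ggsMarking ε).letter x v) (vtx c) =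
      if x = c then directed (ε v) else rotA (coef (ε v) (c - x)) := by
  show sections (rotA x * directed (ε v) * (rotA x)⁻¹) (vtx c) = _
  rw [← rotA_neg, sections_mul, sections_mul, sections_rotA, sections_rotA, rotA_root, rot_vtx,
    sections_directed, one_mul, mul_one]
  simp only [← sub_eq_add_neg, sub_eq_zero, eq_comm]

lemma ggs_ev_root (l : List (ZMod p × V)) : (ggsMarking ε).ev l [] = 1 := by
  induction l with
  | nil => rfl
  | cons q l ih => rw [ev_cons, root_mul, ih, ggs_letter_root, mul_one]

lemma sections_ggs_ev (c : ZMod p) (l : List (ZMod p × V)) :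
    sections ((ggsMarking ε).ev l) (vtx c) = (ggsMarking ε).secVal ε c l := by
  induction l with
  | nil => rfl
  | cons q l ih =>
    rw [ev_cons, sections_mul_of_root (ggs_ev_root ε l), ih, sections_ggs_letter, secVal]
    rfl

lemma ggs_eq_ev {g : AutT p} (hg : g ∈ GGS ε) (h : g [] = 1) :
    ∃ l, g = (ggsMarking ε).ev l := by
  obtain ⟨l, k, rfl⟩ := (ggsMarking ε).mem_gen_iff.mp hg
  rw [root_mul, ggs_ev_root, one_mul] at h
  have hk : k = 0 := rot_eq_one_iff.mp h
  exact ⟨l, by rw [hk, α_zero, mul_one]⟩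

lemma ggs_ev_mul_eq_one {l : List (ZMod p × V)} {k : ZMod p}
    (h : (ggsMarking ε).ev l * (ggsMarking ε).α k = 1) : (ggsMarking ε).ev l = 1 ∧ k = 0 := by
  have hk : k = 0 := by
    have h1 := congrArg (rootHom p) h
    rw [map_mul, map_one] at h1
    have h2 : rootHom p ((ggsMarking ε).ev l) = 1 := ggs_ev_root ε l
    rw [h2, one_mul] at h1
    exact rot_eq_one_iff.mp h1
  refine ⟨?_, hk⟩
  rwa [hk, α_zero, mul_one] at h

lemma selfSimilar_ggs : SelfSimilar (GGS ε) := by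
  intro g hg x
  obtain ⟨l, k, rfl⟩ := (ggsMarking ε).mem_gen_iff.mp hg
  rw [sections_mul]
  obtain ⟨c, hc⟩ := vtx.surjective (((ggsMarking ε).α k) [] x)
  rw [← hc, sections_ggs_ev, secVal_eq]
  have : sections ((ggsMarking ε).α k) x = 1 := sections_rotA k x
  rw [this, mul_one]
  exact mul_mem (ev_mem _ _) (α_mem _ _)

variable {ε}

/-- A word which is trivial in a multi-GGS-group is trivial in every marked group in which
words with trivial sections are trivial. -/
theorem ev_eq_one_of_ggs_ev_eq_one (hε : Function.Injective ε) (D : Marking p V Q)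
    (hD : ∀ l, (∀ c, D.secVal ε c l = 1) → D.ev l = 1) (l : List (ZMod p × V))
    (hl : (ggsMarking ε).ev l = 1) : D.ev l = 1 := by
  by_cases hsame : ∃ x, ∀ q ∈ l, q.1 = x
  · obtain ⟨x, hx⟩ := hsame
    have h0 : (l.map Prod.snd).sum = 0 := by
      rw [ev_of_forall_fst_eq _ hx, letter, mul_inv_eq_one, mul_eq_left] at hl
      exact (map_eq_zero_iff ε hε).mp (directed_eq_one hl)
    rw [ev_of_forall_fst_eq _ hx, h0, letter_zero]
  · push Not at hsame
    refine hD l fun c => ?_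
    have hlt : (secWord ε c l).1.length < l.length := by
      rw [length_secWord]
      obtain ⟨q, hq, hne⟩ := hsame c
      refine lt_of_le_of_ne List.countP_le_length fun h => hne ?_
      simpa using List.countP_eq_length.mp h q hq
    have h1 : (ggsMarking ε).secVal ε c l = 1 := by
      rw [← sections_ggs_ev, hl, sections_one]
    rw [secVal_eq] at h1
    obtain ⟨h2, h3⟩ := ggs_ev_mul_eq_one ε h1
    rw [secVal_eq, ev_eq_one_of_ggs_ev_eq_one hε D hD _ h2, h3, α_zero, mul_one]
termination_by l.length

theorem exists_ggs_hom (hε : Function.Injective ε) (D : Marking p V Q)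
    (hD : ∀ l, (∀ c, D.secVal ε c l = 1) → D.ev l = 1) :
    ∃ φ : GGS ε →* Q, ∀ (g : GGS ε) l k,
      (g : AutT p) = (ggsMarking ε).ev l * (ggsMarking ε).α k → φ g = D.ev l * D.α k := by
  set R := ((ggsMarking ε).prod D).gen
  have hR : ∀ l k, ((ggsMarking ε).ev l * (ggsMarking ε).α k, D.ev l * D.α k) ∈ R :=
    fun l k => (mem_gen_iff _).mpr ⟨l, k, by rw [ev_prod]; rfl⟩
  have hone : ∀ q, ((1 : AutT p), q) ∈ R → q = 1 := by
    intro q hq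
    obtain ⟨l, k, h⟩ := (mem_gen_iff _).mp hq
    rw [ev_prod] at h
    obtain ⟨h1, h2⟩ := Prod.ext_iff.mp h
    obtain ⟨h3, h4⟩ := ggs_ev_mul_eq_one ε h1.symm
    rw [show q = D.ev l * D.α k from h2, ev_eq_one_of_ggs_ev_eq_one hε D hD l h3, h4, α_zero,
      mul_one]
  have huniq : ∀ {g : AutT p} {q q'}, (g, q) ∈ R → (g, q') ∈ R → q = q' := by
    intro g q q' h h'
    have := hone (q * q'⁻¹) (by simpa using mul_mem h (inv_mem h'))
    exact mul_inv_eq_one.mp this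
  have hex : ∀ g : GGS ε, ∃ q, (g.1, q) ∈ R := by
    intro g
    obtain ⟨l, k, h⟩ := (mem_gen_iff _).mp g.2
    exact ⟨_, h ▸ hR l k⟩
  choose φ hφ using hex
  refine ⟨MonoidHom.mk' φ fun g h => huniq (hφ (g * h)) (mul_mem (hφ g) (hφ h)), ?_⟩
  intro g l k h
  exact huniq (hφ g) (h ▸ hR l k)

end Words

section Constant

open Marking

variable (p : ℕ) [Fact p.Prime]

/-- The inclusion of the line of constant vectors. -/
def constVec : ZMod p →ₗ[ZMod p] (Fin (p - 1) → ZMod p) where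
  toFun c _ := c
  map_add' _ _ := rfl
  map_smul' _ _ := rfl

lemma coef_constVec (k : ZMod p) {c : ZMod p} (hc : c ≠ 0) : coef (constVec p k) c = k :=
  coef_const k hc

lemma constVec_injective : Function.Injective (constVec p) := by
  intro k l h
  rw [← coef_constVec p k one_ne_zero, h, coef_constVec p l one_ne_zero]

/-- The affine permutation `z ↦ u z + t` of the complex plane. -/
noncomputable def affinePerm (u : ℂˣ) (t : ℂ) : Equiv.Perm ℂ where
  toFun z := u * z + t
  invFun z := (u⁻¹ : ℂˣ) * (z - t)
  left_inv z := by simp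
  right_inv z := by simp

lemma affinePerm_mul (u u' : ℂˣ) (t t' : ℂ) :
    affinePerm u t * affinePerm u' t' = affinePerm (u * u') (u * t' + t) := by
  ext z
  simp [affinePerm]
  ring

lemma affinePerm_one : affinePerm 1 0 = 1 := by
  ext z
  simp [affinePerm]

lemma affinePerm_eq_one {u : ℂˣ} {t : ℂ} (h : affinePerm u t = 1) : u = 1 ∧ t = 0 := by
  have h0 : (u : ℂ) * 0 + t = 0 := congrArg (fun σ => σ 0) h
  have h1 : (u : ℂ) * 1 + t = 1 := congrArg (fun σ => σ 1) h
  have ht : t = 0 := by simpa using h0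
  refine ⟨?_, ht⟩
  rw [ht] at h1
  exact Units.ext (by simpa using h1)

/-- A faithful character of `ZMod p`. -/
noncomputable def chi (x : ZMod p) : ℂˣ :=
  (ZMod.stdAddChar (N := p)).toMonoidHom.toHomUnits (Multiplicative.ofAdd x)

lemma chi_add (x y : ZMod p) : chi p (x + y) = chi p x * chi p y := by
  rw [chi, ofAdd_add, map_mul]; rfl

lemma chi_zero : chi p 0 = 1 := by
  rw [chi, ofAdd_zero, map_one]

lemma chi_ne_one {x : ZMod p} (hx : x ≠ 0) : chi p x ≠ 1 := by
  intro h
  apply hx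
  apply ZMod.injective_stdAddChar (N := p)
  rw [AddChar.map_zero_eq_one]
  exact congrArg Units.val h

/-- The marking of a group of affine permutations of the complex plane by the rotations
about `0` and the rotations about `1`. -/
noncomputable def affineMarking : Marking p (ZMod p) (Equiv.Perm ℂ) where
  α x := affinePerm (chi p x) 0
  β v := affinePerm (chi p v) (1 - chi p v)
  α_add x y := by rw [affinePerm_mul, chi_add, mul_zero, add_zero]
  β_add x y := by
    rw [affinePerm_mul, chi_add]
    congr 1
    push_cast
    ring

lemma affineMarking_letter (x v : ZMod p) :
    (affineMarking p).letter x v = affinePerm (chi p v) (chi p x * (1 - chi p v)) := by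
  rw [letter, mul_inv_eq_iff_eq_mul]
  show affinePerm _ _ * affinePerm _ _ = affinePerm _ _ * affinePerm _ _
  rw [affinePerm_mul, affinePerm_mul, mul_comm (chi p x)]
  simp

lemma affineMarking_secVal_ev (l : List (ZMod p × ZMod p)) :
    ∃ (u : ℂˣ) (t : ZMod p → ℂ), (∀ c, (affineMarking p).secVal (constVec p) c l =
        affinePerm u (t c)) ∧
      (affineMarking p).ev l = affinePerm u (∑ c, chi p c * t c) := by
  induction l with
  | nil => exact ⟨1, 0, fun c => affinePerm_one.symm, by simp [ev_nil, affinePerm_one]⟩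
  | cons q l ih =>
    obtain ⟨u, t, h1, h2⟩ := ih
    refine ⟨chi p q.2 * u, fun c => chi p q.2 * t c + if q.1 = c then (1 - chi p q.2 : ℂ) else 0,
      fun c => ?_, ?_⟩
    · rw [secVal, h1]
      simp only
      by_cases h : q.1 = c
      · rw [if_pos h, if_pos h]
        exact affinePerm_mul _ _ _ _
      · rw [if_neg h, if_neg h, coef_constVec p q.2 (sub_ne_zero.mpr (Ne.symm h))]
        exact affinePerm_mul _ _ _ _
    · rw [ev_cons, h2, affineMarking_letter, affinePerm_mul]
      congr 1
      simp only [mul_add, Finset.sum_add_distrib, mul_ite, mul_zero, Finset.sum_ite_eq,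
        Finset.mem_univ, if_true, Finset.mul_sum]
      congr 1
      exact Finset.sum_congr rfl fun c _ => by ring

theorem not_justInfinite_ggs_constVec (hp : p ≠ 2) : ¬ JustInfinite (GGS (constVec p)) := by
  rintro ⟨-, hJ⟩
  obtain ⟨φ, hφ⟩ := exists_ggs_hom (constVec_injective p) (affineMarking p) (by
    intro l hl
    obtain ⟨u, t, h1, h2⟩ := affineMarking_secVal_ev p l
    have h3 : ∀ c, u = 1 ∧ t c = 0 := fun c => affinePerm_eq_one ((h1 c).symm.trans (hl c))
    rw [h2, (h3 0).1, Finset.sum_eq_zero fun c _ => by rw [(h3 c).2, mul_zero], affinePerm_one])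
  set D := ggsMarking (constVec p)
  have hker : φ.ker ≠ ⊥ := by
    intro hbot
    let g : GGS (constVec p) := ⟨D.ev [(0, 2), (-1, -1), (1, -1)], D.ev_mem _⟩
    have hg : g ∈ φ.ker := by
      rw [MonoidHom.mem_ker, hφ g [(0, 2), (-1, -1), (1, -1)] 0 (by rw [α_zero, mul_one]),
        α_zero, mul_one]
      simp only [ev_cons, ev_nil, affineMarking_letter, mul_one, affinePerm_mul, ← chi_add]
      rw [← affinePerm_one]
      have h2 : chi p 2 = chi p 1 * chi p 1 := by rw [← chi_add, one_add_one_eq_two]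
      have hn : (chi p 1 : ℂ) * chi p (-1) = 1 := by
        rw [← Units.val_mul, ← chi_add, add_neg_cancel, chi_zero, Units.val_one]
      congr 1
      · rw [show (2 : ZMod p) + (-1 + -1) = 0 by ring, chi_zero]
      · rw [h2, chi_zero]
        push_cast
        linear_combination ((chi p 1 : ℂ) ^ 2 * (1 - chi p (-1)) - (1 + chi p 1 * chi p (-1))) * hn
    rw [hbot, Subgroup.mem_bot] at hg
    have h1 : D.ev [(0, 2), (-1, -1), (1, -1)] = 1 := congrArg Subtype.val hg
    have h2 := sections_ggs_ev (constVec p) 0 [(0, 2), (-1, -1), (1, -1)]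
    have h3 : rootHom p (directed (constVec p 2) * (rotA (-1) * rotA (-1))) = 1 := by
      rw [h1, sections_one] at h2
      simp [secVal, coef_constVec] at h2
      exact (congrArg (rootHom p) h2.symm).trans (map_one _)
    rw [← rotA_add, map_mul] at h3
    have h4 : rot (-1 + -1 : ZMod p) = 1 := h3
    rw [rot_eq_one_iff, ← neg_add, neg_eq_zero, one_add_one_eq_two] at h4
    have h5 : ((2 : ℕ) : ZMod p) = 0 := by exact_mod_cast h4
    rw [ZMod.natCast_eq_zero_iff, Nat.dvd_prime Nat.prime_two] at h5
    exact h5.elim (Fact.out : p.Prime).ne_one hp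
  have hfin : φ.ker.FiniteIndex := hJ _ inferInstance hker
  let b : GGS (constVec p) := ⟨D.ev [(0, 1)] * D.α (-1), mul_mem (D.ev_mem _) (D.α_mem _)⟩
  have hb : φ b = affinePerm 1 (1 - chi p 1) := by
    rw [hφ b _ _ rfl, ev_cons, ev_nil, mul_one, affineMarking_letter]
    refine (affinePerm_mul _ _ _ _).trans ?_
    rw [← chi_add, add_neg_cancel, chi_zero, Units.val_one, one_mul, mul_zero, zero_add]
  have hpow : ∀ n : ℕ, (affinePerm 1 (1 - chi p 1)) ^ n = affinePerm 1 (n * (1 - chi p 1)) := by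
    intro n
    induction n with
    | zero => simp [affinePerm_one]
    | succ n ih =>
      rw [pow_succ, ih, affinePerm_mul, one_mul]
      congr 1
      push_cast
      ring
  obtain ⟨n, hn, -, hmem⟩ := Subgroup.exists_pow_mem_of_index_ne_zero hfin.index_ne_zero b
  rw [MonoidHom.mem_ker, map_pow, hb, hpow] at hmem
  have h0 := (affinePerm_eq_one hmem).2
  rcases mul_eq_zero.mp h0 with h | h
  · exact hn.ne' (by exact_mod_cast h)
  · exact chi_ne_one p one_ne_zero (Units.ext (sub_eq_zero.mp h).symm)

lemma ggs_constVec {c : ZMod p} (hc : c ≠ 0) : GGS (constVec p) = constGGS p c := by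
  apply le_antisymm
  · rw [GGS, gen, Subgroup.closure_le]
    rintro _ (⟨x, rfl⟩ | ⟨v, rfl⟩)
    · rw [← mul_one x]
      exact α_smul_mem (ggsMarking (constVec p)) (x := 1)
        (Subgroup.subset_closure (Or.inl rotA_one)) x
    · rw [← div_mul_cancel₀ v hc]
      exact β_smul_mem (ggsMarking (constVec p)) (v := c)
        (Subgroup.subset_closure (Or.inr rfl)) (v / c)
  · rw [constGGS, Subgroup.closure_le]
    rintro _ (rfl | rfl)
    · exact rotA_one (p := p) ▸ (ggsMarking (constVec p)).α_mem 1
    · exact (ggsMarking (constVec p)).β_mem c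

end Constant

section Exponents

open Marking

variable {p : ℕ} {V Q : Type*} [AddCommGroup V] [Group Q]

/-- The exponent sum of the letters of index `c` in a word. -/
def expSum (c : ZMod p) : List (ZMod p × V) → V
  | [] => 0
  | q :: l => (if q.1 = c then q.2 else 0) + expSum c l

lemma Marking.ev_mem_commutator [NeZero p] (D : Marking p V Q) {L : Subgroup Q}
    (hL : ∀ x v, D.letter x v ∈ L) {l : List (ZMod p × V)} (hl : ∀ c, expSum c l = 0) :
    D.ev l ∈ ⁅L, L⁆ := by
  have hev : ∀ l, D.ev l ∈ L := by
    intro l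
    induction l with
    | nil => exact one_mem _
    | cons q l ih => exact mul_mem (hL _ _) ih
  have key : ∀ l, Abelianization.of (⟨D.ev l, hev l⟩ : L) =
      ∏ c, Abelianization.of (⟨D.letter c (expSum c l), hL _ _⟩ : L) := by
    intro l
    induction l with
    | nil =>
      rw [Finset.prod_eq_one]
      · exact map_one _
      · intro c _
        rw [← map_one Abelianization.of]
        exact congrArg _ (Subtype.ext (D.letter_zero c))
    | cons q l ih =>
      have h1 : (⟨D.ev (q :: l), hev _⟩ : L) = ⟨D.letter q.1 q.2, hL _ _⟩ * ⟨D.ev l, hev l⟩ := rfl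
      have h2 : ∀ c, (⟨D.letter c (expSum c (q :: l)), hL _ _⟩ : L) =
          (if q.1 = c then ⟨D.letter q.1 q.2, hL _ _⟩ else 1) *
            ⟨D.letter c (expSum c l), hL _ _⟩ := by
        intro c
        apply Subtype.ext
        show D.letter c (_ + expSum c l) = _
        rw [letter_add]
        split_ifs with h
        · rw [← h]; rfl
        · rw [letter_zero]; rfl
      simp only [h1, h2, map_mul, ih, Finset.prod_mul_distrib]
      congr 1
      rw [Finset.prod_eq_single q.1]
      · rw [if_pos rfl]
      · intro c _ hc
        rw [if_neg hc.symm, map_one]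
      · simp
  have h3 := key l
  rw [Finset.prod_eq_one fun c _ => ?_] at h3
  · rw [← Subgroup.map_subtype_commutator]
    refine ⟨⟨D.ev l, hev l⟩, ?_, rfl⟩
    rw [SetLike.mem_coe, ← Abelianization.ker_of]
    exact h3
  · rw [← map_one Abelianization.of]
    refine congrArg _ (Subtype.ext ?_)
    show D.letter c _ = 1
    rw [hl, letter_zero]

/-- The marking of the additive group `V` in which the elements of `ZMod p` are trivial. -/
def expMarking (p : ℕ) (V : Type*) [AddCommGroup V] : Marking p V (Multiplicative V) where
  α _ := 1
  β v := Multiplicative.ofAdd v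
  α_add _ _ := (mul_one 1).symm
  β_add _ _ := rfl

lemma expMarking_ev [NeZero p] (l : List (ZMod p × V)) :
    (expMarking p V).ev l = Multiplicative.ofAdd (∑ c, expSum c l) := by
  induction l with
  | nil => simp [ev_nil, expSum]
  | cons q l ih =>
    simp only [ev_cons, ih, expSum, Finset.sum_add_distrib, Finset.sum_ite_eq, Finset.mem_univ,
      if_true, ofAdd_add]
    congr 1
    rw [letter, mul_comm, inv_mul_cancel_left]
    rfl

variable [Fact p.Prime] [Module (ZMod p) V] {ε : V →ₗ[ZMod p] (Fin (p - 1) → ZMod p)}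

lemma expMarking_secVal (c : ZMod p) (l : List (ZMod p × V)) :
    (expMarking p V).secVal ε c l = Multiplicative.ofAdd (expSum c l) := by
  induction l with
  | nil => rfl
  | cons q l ih =>
    rw [secVal, ih, expSum, ofAdd_add]
    split_ifs <;> rfl

lemma exists_exponent (hε : Function.Injective ε) :
    ∃ B : GGS ε →* Multiplicative V, ∀ (g : GGS ε) l k,
      (g : AutT p) = (ggsMarking ε).ev l * (ggsMarking ε).α k →
        B g = (expMarking p V).ev l := by
  obtain ⟨B, hB⟩ := exists_ggs_hom hε (expMarking p V) (by
    intro l hl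
    rw [expMarking_ev, Finset.sum_eq_zero, ofAdd_zero]
    intro c _
    have := hl c
    rwa [expMarking_secVal, ofAdd_eq_one] at this)
  exact ⟨B, fun g l k h => (hB g l k h).trans (mul_one _)⟩

lemma secVal_root (c : ZMod p) (l : List (ZMod p × V)) :
    (ggsMarking ε).secVal ε c l [] = rot (∑ y, coef (ε (expSum y l)) (c - y)) := by
  induction l with
  | nil => simp [secVal, expSum, root_one, rot_zero]
  | cons q l ih =>
    rw [secVal, root_mul, ih]
    simp only [expSum, map_add, Pi.add_apply, Finset.sum_add_distrib, rot_add]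
    congr 1
    rw [Finset.sum_eq_single q.1]
    · rw [if_pos rfl]
      split_ifs with h
      · rw [h, sub_self, coef_zero, rot_zero]
        exact directed_root (ε q.2)
      · exact rotA_root _
    · intro y _ hy
      rw [if_neg hy.symm, map_zero, map_zero, Pi.zero_apply]
    · simp

/-- The power moments of a function on `ZMod p`. -/
def moment (t : ℕ) : (ZMod p → ZMod p) →ₗ[ZMod p] ZMod p where
  toFun f := ∑ z, z ^ t * f z
  map_add' f g := by simp [mul_add, Finset.sum_add_distrib]
  map_smul' c f := by simp [Finset.mul_sum, mul_left_comm]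

lemma eq_zero_of_moment_eq_zero {f : ZMod p → ZMod p} (h : ∀ t < p, moment t f = 0) : f = 0 := by
  have h1 : f ∘ vtx.symm = 0 := by
    refine Matrix.eq_zero_of_forall_pow_sum_mul_pow_eq_zero (f := vtx.symm) vtx.symm.injective ?_
    intro t
    refine (Equiv.sum_comp vtx.symm fun z => f z * z ^ (t : ℕ)).trans ?_
    rw [← h t t.2]
    exact Finset.sum_congr rfl fun z _ => mul_comm _ _
  funext c
  simpa using congrFun h1 (vtx c)

lemma moment_translate (m : ℕ) (y : ZMod p) (f : ZMod p → ZMod p)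
    (hf : ∀ t < m, moment t f = 0) : ∑ c, c ^ m * f (c - y) = moment m f := by
  rw [← Equiv.sum_comp (Equiv.addRight y)]
  simp only [Equiv.coe_addRight, add_sub_cancel_right, add_pow, Finset.sum_mul]
  rw [Finset.sum_comm, Finset.sum_range_succ, Finset.sum_eq_zero, zero_add]
  · simp [moment]
  · intro t ht
    have := hf t (Finset.mem_range.mp ht)
    calc _ = y ^ (m - t) * (m.choose t) * moment t f := by
          simp only [moment, LinearMap.coe_mk, AddHom.coe_mk, Finset.mul_sum]
          exact Finset.sum_congr rfl fun z _ => by ring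
      _ = 0 := by rw [this, mul_zero]

lemma exponent_sections {B : GGS ε →* Multiplicative V} (hB : ∀ (g : GGS ε) l k,
      (g : AutT p) = (ggsMarking ε).ev l * (ggsMarking ε).α k → B g = (expMarking p V).ev l)
    {g : GGS ε} {l : List (ZMod p × V)} (hl : (g : AutT p) = (ggsMarking ε).ev l) (c : ZMod p) :
    B ⟨_, selfSimilar_ggs ε _ g.2 (vtx c)⟩ = Multiplicative.ofAdd (expSum c l) := by
  rw [hB _ (secWord ε c l).1 (secWord ε c l).2 (by
    show sections g.1 _ = _
    rw [hl, sections_ggs_ev, secVal_eq]), ← expMarking_secVal (ε := ε), secVal_eq]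
  exact (mul_one _).symm

lemma moment_exponent {B : GGS ε →* Multiplicative V} (hB : ∀ (g : GGS ε) l k,
      (g : AutT p) = (ggsMarking ε).ev l * (ggsMarking ε).α k → B g = (expMarking p V).ev l)
    (m : ℕ) : ∀ g : GGS ε, (g : AutT p) ∈ levelStab p (m + 1) → ∀ t < m,
      moment t (coef (ε (B g).toAdd)) = 0 := by
  induction m with
  | zero => intro g _ t ht; omega
  | succ m ih =>
    intro g hg t ht
    obtain ⟨hroot, hsec⟩ := mem_levelStab_succ.mp hg
    obtain ⟨l, hl⟩ := ggs_eq_ev ε g.2 hroot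
    have hBg : (B g).toAdd = ∑ c, expSum c l := by
      rw [hB g l 0 (by rw [hl, α_zero, mul_one]), expMarking_ev]
      rfl
    have hn : ∀ c, ∀ t < m, moment t (coef (ε (expSum c l))) = 0 := by
      intro c
      have h1 := ih ⟨_, selfSimilar_ggs ε _ g.2 (vtx c)⟩ (hsec (vtx c))
      rwa [exponent_sections hB hl] at h1
    rw [hBg]
    simp only [map_sum]
    rcases Nat.lt_succ_iff_lt_or_eq.mp ht with h | rfl
    · exact Finset.sum_eq_zero fun c _ => hn c t h
    · rw [← Finset.sum_congr rfl fun c _ => moment_translate t c _ (hn c), Finset.sum_comm]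
      refine Finset.sum_eq_zero fun c _ => ?_
      rw [← Finset.mul_sum]
      have h1 := (mem_levelStab_succ.mp (hsec (vtx c))).1
      rw [hl, sections_ggs_ev, secVal_root, rot_eq_one_iff] at h1
      rw [h1, mul_zero]

lemma expSum_eq_zero_of_mem_levelStab (hε : Function.Injective ε) {l : List (ZMod p × V)}
    (hl : (ggsMarking ε).ev l ∈ levelStab p (p + 2)) (c : ZMod p) : expSum c l = 0 := by
  obtain ⟨B, hB⟩ := exists_exponent hε
  let g : GGS ε := ⟨_, (ggsMarking ε).ev_mem l⟩
  have h1 := (mem_levelStab_succ.mp hl).2 (vtx c)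
  have h2 := moment_exponent hB p ⟨_, selfSimilar_ggs ε _ g.2 (vtx c)⟩ h1
  rw [exponent_sections hB (l := l) rfl] at h2
  have h3 := coef_injective ((eq_zero_of_moment_eq_zero h2).trans (map_zero coef).symm)
  exact hε (h3.trans (map_zero ε).symm)

end Exponents

section Generation

open Marking

variable {p : ℕ} {V Q : Type*} [AddCommGroup V] [Group Q]

lemma Marking.eq_top_of_mem (D : Marking p V Q) (hD : D.gen = ⊤) {T : Subgroup Q}
    (hα : ∀ x, D.α x ∈ T) (hβ : ∀ v, D.β v ∈ T) : T = ⊤ := by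
  rw [eq_top_iff, ← hD, gen, Subgroup.closure_le]
  rintro _ (⟨x, rfl⟩ | ⟨v, rfl⟩)
  exacts [hα x, hβ v]

variable [Fact p.Prime]

lemma Marking.α_mem_of_ne_zero (D : Marking p V Q) {T : Subgroup Q} {k : ZMod p} (hk : k ≠ 0)
    (h : D.α k ∈ T) (x : ZMod p) : D.α x ∈ T := by
  have := D.α_smul_mem h (x / k)
  rwa [div_mul_cancel₀ x hk] at this

variable [Module (ZMod p) V]

/-- Some defining vector is not constant. -/
def NonconstVec (ε : V →ₗ[ZMod p] (Fin (p - 1) → ZMod p)) : Prop :=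
  ∃ v c d, c ≠ 0 ∧ d ≠ 0 ∧ coef (ε v) c ≠ coef (ε v) d

variable {ε : V →ₗ[ZMod p] (Fin (p - 1) → ZMod p)}

lemma NonconstVec.exists_ne_zero (hnc : NonconstVec ε) : ∃ v c, c ≠ 0 ∧ coef (ε v) c ≠ 0 := by
  obtain ⟨v, c, d, hc, hd, h⟩ := hnc
  by_cases h0 : coef (ε v) c = 0
  · exact ⟨v, d, hd, fun h1 => h (h0.trans h1.symm)⟩
  · exact ⟨v, c, hc, h0⟩

lemma coef_eq_of_geometric {f : ZMod p → ZMod p} {d lam : ZMod p} (hd : d ≠ 0)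
    (h : ∀ y, y ≠ 0 → y ≠ d → f (y - d) = lam * f y) (n : ℕ) (hn : n + 1 < p) :
    f ((n + 1 : ℕ) * d) * lam ^ n = f d := by
  induction n with
  | zero => simp
  | succ n ih =>
    rw [← ih (by omega), pow_succ]
    have h1 : ((n + 1 + 1 : ℕ) : ZMod p) ≠ 0 := by
      rw [Ne, ZMod.natCast_eq_zero_iff]
      exact Nat.not_dvd_of_pos_of_lt (by omega) hn
    have h2 : ((n + 1 : ℕ) : ZMod p) ≠ 0 := by
      rw [Ne, ZMod.natCast_eq_zero_iff]
      exact Nat.not_dvd_of_pos_of_lt (by omega) (by omega)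
    have h3 := h ((n + 1 + 1 : ℕ) * d) (mul_ne_zero h1 hd) (by
      intro h4
      push_cast at h4 h2
      refine mul_ne_zero h2 hd ?_
      linear_combination h4)
    rw [show ((n + 1 + 1 : ℕ) : ZMod p) * d - d = ((n + 1 : ℕ) : ZMod p) * d by
      push_cast; ring] at h3
    rw [h3]
    ring

/-- The subgroup which enters in the proof that multi-GGS-groups are branch groups. -/
theorem Marking.eq_top_of_coef (D : Marking p V Q) (hD : D.gen = ⊤) (hp : p ≠ 2)
    (hnc : NonconstVec ε) {T : Subgroup Q} {v : V}
    (hα : ∀ d w, d ≠ 0 → coef (ε w) (-d) ≠ 0 → ∀ x₁ x₂ v₁ v₂, x₁ ≠ 0 → x₁ ≠ d → x₂ ≠ 0 →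
      x₂ ≠ d → D.α (coef (ε v₂) (d - x₂) * coef (ε v₁) (-x₁) -
        coef (ε v₁) (d - x₁) * coef (ε v₂) (-x₂)) ∈ T)
    (hβ : ∀ d w, d ≠ 0 → coef (ε w) (-d) ≠ 0 → ∀ x₁ v₁ v', x₁ ≠ 0 → x₁ ≠ d →
      coef (ε v₁) (d - x₁) ≠ 0 → D.β v' * D.α (-(coef (ε v') d / coef (ε v₁) (d - x₁)) *
        coef (ε v₁) (-x₁)) ∈ T)
    (htop : ∀ d w, d ≠ 0 → coef (ε w) (-d) ≠ 0 → coef (ε v) d = 0 → T = ⊤) : T = ⊤ := by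
  have h2 : (2 : ZMod p) ≠ 0 := by
    intro h
    have h' : ((2 : ℕ) : ZMod p) = 0 := by exact_mod_cast h
    rw [ZMod.natCast_eq_zero_iff, Nat.dvd_prime Nat.prime_two] at h'
    exact h'.elim (Fact.out : p.Prime).ne_one hp
  have fin : ∀ d w x₁ v₁ k, d ≠ 0 → coef (ε w) (-d) ≠ 0 → x₁ ≠ 0 → x₁ ≠ d →
      coef (ε v₁) (d - x₁) ≠ 0 → k ≠ 0 → D.α k ∈ T → T = ⊤ := by
    intro d w x₁ v₁ k hd hw hx hxd hg hk hmem
    have hall := D.α_mem_of_ne_zero hk hmem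
    exact D.eq_top_of_mem hD hall fun v' =>
      (Subgroup.mul_mem_cancel_right _ (hall _)).mp (hβ d w hd hw x₁ v₁ v' hx hxd hg)
  obtain ⟨w, d', hd', hw⟩ := hnc.exists_ne_zero
  obtain ⟨d, rfl⟩ : ∃ d, d' = -d := ⟨-d', (neg_neg d').symm⟩
  have hd : d ≠ 0 := neg_ne_zero.mp hd'
  have h2d : 2 * d ≠ 0 := mul_ne_zero h2 hd
  have h2d' : 2 * d ≠ d := fun h => hd (by linear_combination h)
  have hdd : d - 2 * d = -d := by ring
  by_cases hcross : ∃ x₁ x₂ v₁ v₂, x₁ ≠ 0 ∧ x₁ ≠ d ∧ x₂ ≠ 0 ∧ x₂ ≠ d ∧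
      coef (ε v₂) (d - x₂) * coef (ε v₁) (-x₁) -
        coef (ε v₁) (d - x₁) * coef (ε v₂) (-x₂) ≠ 0
  · obtain ⟨x₁, x₂, v₁, v₂, h₁, h₁', h₂, h₂', hne⟩ := hcross
    exact fin d w (2 * d) w _ hd hw h2d h2d' (by rwa [hdd]) hne
      (hα d w hd hw x₁ x₂ v₁ v₂ h₁ h₁' h₂ h₂')
  · push Not at hcross
    set lam := coef (ε w) (-(2 * d)) / coef (ε w) (-d) with hlam
    have hrec : ∀ v' y, y ≠ 0 → y ≠ d → coef (ε v') (y - d) = lam * coef (ε v') y := by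
      intro v' y hy hyd
      have h := hcross (2 * d) (d - y) w v' h2d h2d' (sub_ne_zero.mpr hyd.symm)
        (fun h => hy (by linear_combination -h))
      rw [hdd, sub_sub_cancel, neg_sub] at h
      rw [hlam, div_mul_eq_mul_div, eq_div_iff hw]
      exact ((mul_comm _ _).trans (sub_eq_zero.mp h).symm).trans (mul_comm _ _)
    have hd2 : ∀ v', coef (ε v') d = lam * coef (ε v') (2 * d) := fun v' => by
      rw [← hrec v' (2 * d) h2d h2d', show 2 * d - d = d by ring]
    by_cases hl0 : lam = 0
    · exact htop d w hd hw (by rw [hd2, hl0, zero_mul])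
    have hneg : ∀ v', coef (ε v') (-d) = lam * coef (ε v') d := by
      intro v'
      have hp2 : 2 ≤ p := (Fact.out : p.Prime).two_le
      have h := coef_eq_of_geometric hd (hrec v') (p - 2) (by omega)
      have h1 : ((p - 2 + 1 : ℕ) : ZMod p) = -1 := by
        rw [eq_neg_iff_add_eq_zero]
        have : ((p - 2 + 1 + 1 : ℕ) : ZMod p) = 0 := by
          rw [ZMod.natCast_eq_zero_iff]
          exact dvd_of_eq (by omega)
        exact_mod_cast this
      have h3 : lam ^ (p - 2) * lam = 1 := by
        rw [← pow_succ, show p - 2 + 1 = p - 1 by omega]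
        exact ZMod.pow_card_sub_one_eq_one hl0
      rw [h1, neg_one_mul] at h
      linear_combination lam * h - coef (ε v') (-d) * h3
    have hwd : coef (ε w) d ≠ 0 := fun h => hw (by rw [hneg, h, mul_zero])
    by_cases hl1 : lam = 1
    · exfalso
      obtain ⟨u, c₁, c₂, hc₁, hc₂, hne⟩ := hnc
      have hall : ∀ c, c ≠ 0 → coef (ε u) c = coef (ε u) d := by
        intro c hc
        have hcd : c / d ≠ 0 := div_ne_zero hc hd
        have hval : (c / d).val ≠ 0 := by rwa [Ne, ZMod.val_eq_zero]
        have hlt := ZMod.val_lt (c / d)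
        have h := coef_eq_of_geometric hd (hrec u) ((c / d).val - 1) (by omega)
        rwa [show (c / d).val - 1 + 1 = (c / d).val by omega, ZMod.natCast_zmod_val,
          div_mul_cancel₀ c hd, hl1, one_pow, mul_one] at h
      exact hne ((hall c₁ hc₁).trans (hall c₂ hc₂).symm)
    · have m₁ := hβ d w hd hw (2 * d) w w h2d h2d' (by rwa [hdd])
      have m₂ := hβ (-d) w hd' (by rwa [neg_neg]) (-(2 * d)) w w (neg_ne_zero.mpr h2d)
        (fun h => h2d' (neg_injective h)) (by rwa [show -d - -(2 * d) = d by ring])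
      rw [hdd] at m₁
      rw [neg_neg, show -d - -(2 * d) = d by ring] at m₂
      have m₃ := mul_mem (inv_mem m₂) m₁
      rw [mul_inv_rev, mul_assoc, inv_mul_cancel_left, ← α_neg, ← D.α_add] at m₃
      refine fin d w (2 * d) w _ hd hw h2d h2d' (by rwa [hdd]) ?_ m₃
      have e₁ : coef (ε w) (-(2 * d)) = lam * coef (ε w) (-d) := by
        rw [hlam, div_mul_cancel₀ _ hw]
      rw [e₁, hneg w]
      have e₂ := hd2 w
      intro h
      have hw2 : coef (ε w) (2 * d) ≠ 0 := fun h => hwd (by rw [e₂, h, mul_zero])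
      rw [e₂] at h
      field_simp at h
      rcases mul_eq_zero.mp h with h | h
      · exact mul_ne_zero hl0 hw2 h
      · exact hl1 (by linear_combination -h)

end Generation

section Branching

open Marking

lemma commutator_closure_le {Q : Type*} [Group Q] {N : Subgroup Q} [N.Normal] {T : Set Q}
    (h : ∀ s ∈ T, ∀ t ∈ T, ⁅s, t⁆ ∈ N) :
    ⁅Subgroup.closure T, Subgroup.closure T⁆ ≤ N := by
  have key : ∀ g h : Q, ⁅g, h⁆ ∈ N ↔ Commute (g : Q ⧸ N) (h : Q ⧸ N) := fun g h => by
    rw [← commutatorElement_eq_one_iff_commute, ← QuotientGroup.eq_one_iff]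
    rfl
  rw [Subgroup.commutator_le]
  intro g hg k hk
  rw [key]
  induction hg, hk using Subgroup.closure_induction₂ with
  | mem x y hx hy => exact (key x y).mp (h x hx y hy)
  | one_left x hx => exact Commute.one_left _
  | one_right x hx => exact Commute.one_right _
  | mul_left x y z hx hy hz h1 h2 => exact h1.mul_left h2
  | mul_right y z x hy hz hx h1 h2 => exact h1.mul_right h2
  | inv_left x y hx hy h => exact h.inv_left
  | inv_right x y hx hy h => exact h.inv_right

variable {p : ℕ} [Fact p.Prime] {V : Type*} [AddCommGroup V] [Module (ZMod p) V]
  (ε : V →ₗ[ZMod p] (Fin (p - 1) → ZMod p))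

/-- The marking of a multi-GGS-group, with values in the group itself. -/
def selfMarking : Marking p V (GGS ε) where
  α x := ⟨_, (ggsMarking ε).α_mem x⟩
  β v := ⟨_, (ggsMarking ε).β_mem v⟩
  α_add x y := Subtype.ext ((ggsMarking ε).α_add x y)
  β_add v w := Subtype.ext ((ggsMarking ε).β_add v w)

lemma coe_selfMarking_letter (x : ZMod p) (v : V) :
    ((selfMarking ε).letter x v : AutT p) = (ggsMarking ε).letter x v := rfl

lemma coe_selfMarking_ev (l : List (ZMod p × V)) :
    ((selfMarking ε).ev l : AutT p) = (ggsMarking ε).ev l := by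
  induction l with
  | nil => rfl
  | cons q l ih => rw [ev_cons, ev_cons, Subgroup.coe_mul, ih, coe_selfMarking_letter]

lemma selfMarking_gen : (selfMarking ε).gen = ⊤ := by
  rw [eq_top_iff]
  intro g _
  obtain ⟨l, k, h⟩ := (ggsMarking ε).mem_gen_iff.mp g.2
  rw [mem_gen_iff]
  exact ⟨l, k, Subtype.ext (by rw [h, Subgroup.coe_mul, coe_selfMarking_ev]; rfl)⟩

/-- The first-level stabilizer of a multi-GGS-group. -/
def stabOne : Subgroup (GGS ε) := ((rootHom p).comp (GGS ε).subtype).ker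

instance : (stabOne ε).Normal := inferInstanceAs (MonoidHom.ker _).Normal

/-- The section at the index `c`, as a homomorphism on the first-level stabilizer. -/
def secHom (c : ZMod p) : stabOne ε →* GGS ε where
  toFun g := ⟨_, selfSimilar_ggs ε _ g.1.2 (vtx c)⟩
  map_one' := rfl
  map_mul' _ h := Subtype.ext (sections_mul_of_root h.2 (vtx c))

lemma letter_mem_stabOne (x : ZMod p) (v : V) : (selfMarking ε).letter x v ∈ stabOne ε :=
  ggs_letter_root ε x v

/-- The conjugates of the directed generators, as elements of the first-level stabilizer. -/
def stabLetter (x : ZMod p) (v : V) : stabOne ε := ⟨_, letter_mem_stabOne ε x v⟩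

lemma secHom_stabLetter_self (x : ZMod p) (v : V) :
    secHom ε x (stabLetter ε x v) = (selfMarking ε).β v :=
  Subtype.ext ((sections_ggs_letter ε x x v).trans (if_pos rfl))

lemma secHom_stabLetter {c x : ZMod p} (h : x ≠ c) (v : V) :
    secHom ε c (stabLetter ε x v) = (selfMarking ε).α (coef (ε v) (c - x)) :=
  Subtype.ext ((sections_ggs_letter ε x c v).trans (if_neg h))

lemma stabOne_eq_closure :
    stabOne ε =
      Subgroup.closure (Set.range fun q : ZMod p × V => (selfMarking ε).letter q.1 q.2) := by
  apply le_antisymm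
  · intro g hg
    obtain ⟨l, hl⟩ := ggs_eq_ev ε g.2 hg
    have h : g = (selfMarking ε).ev l := Subtype.ext (hl.trans (coe_selfMarking_ev ε l).symm)
    rw [h]
    clear h hl
    induction l with
    | nil => exact one_mem _
    | cons q l ih => exact mul_mem (Subgroup.subset_closure ⟨q, rfl⟩) ih
  · rw [Subgroup.closure_le]
    rintro _ ⟨q, rfl⟩
    exact letter_mem_stabOne ε _ _

/-- The third term of the lower central series. -/
def gammaThree : Subgroup (GGS ε) := ⁅⁅(⊤ : Subgroup (GGS ε)), (⊤ : Subgroup (GGS ε))⁆, ⊤⁆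

/-- The fourth term of the lower central series. -/
def gammaFour : Subgroup (GGS ε) := ⁅gammaThree ε, ⊤⁆

/-- The third term of the lower central series of the first-level stabilizer. -/
def gammaThreeStab : Subgroup (GGS ε) := ⁅⁅stabOne ε, stabOne ε⁆, stabOne ε⁆

instance : (gammaThree ε).Normal := Subgroup.commutator_normal _ _

instance : (gammaFour ε).Normal := Subgroup.commutator_normal _ _

instance : (gammaThreeStab ε).Normal := Subgroup.commutator_normal _ _

lemma letter_eq_commutator_mul (x : ZMod p) (v : V) :
    (selfMarking ε).letter x v =
      ⁅(selfMarking ε).α x, (selfMarking ε).β v⁆ * (selfMarking ε).β v := by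
  rw [letter, commutatorElement_def]
  group

lemma commutator_stabOne_le : ⁅stabOne ε, stabOne ε⁆ ≤ gammaThree ε := by
  rw [stabOne_eq_closure]
  apply commutator_closure_le
  rintro _ ⟨⟨x, v⟩, rfl⟩ _ ⟨⟨y, w⟩, rfl⟩
  have key : ∀ g h : GGS ε, ⁅g, h⁆ ∈ gammaThree ε ↔
      Commute (g : GGS ε ⧸ gammaThree ε) (h : GGS ε ⧸ gammaThree ε) := fun g h => by
    rw [← commutatorElement_eq_one_iff_commute, ← QuotientGroup.eq_one_iff]
    rfl
  have hcen : ∀ g h k : GGS ε, Commute ((⁅g, h⁆ : GGS ε) : GGS ε ⧸ gammaThree ε) k :=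
    fun g h k => (key _ _).mp (Subgroup.commutator_mem_commutator
      (Subgroup.commutator_mem_commutator (Subgroup.mem_top g) (Subgroup.mem_top h))
      (Subgroup.mem_top k))
  have hβ : Commute ((selfMarking ε).β v) ((selfMarking ε).β w) := by
    rw [Commute, SemiconjBy, ← (selfMarking ε).β_add, add_comm, (selfMarking ε).β_add]
  rw [key]
  simp only [letter_eq_commutator_mul, QuotientGroup.mk_mul]
  exact ((hcen _ _ _).mul_right (hcen _ _ _)).mul_left ((hcen _ _ _).symm.mul_right
    (hβ.map (QuotientGroup.mk' (gammaThree ε))))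

lemma gammaThreeStab_le : gammaThreeStab ε ≤ gammaFour ε :=
  Subgroup.commutator_mono (commutator_stabOne_le ε) le_top

variable {ε}

lemma secHom_surjective (hnc : NonconstVec ε) (c : ZMod p) : Function.Surjective (secHom ε c) := by
  rw [← MonoidHom.range_eq_top]
  obtain ⟨v, d, hd, hv⟩ := hnc.exists_ne_zero
  refine (selfMarking ε).eq_top_of_mem (selfMarking_gen ε)
    ((selfMarking ε).α_mem_of_ne_zero hv ⟨stabLetter ε (c - d) v, ?_⟩)
    fun w => ⟨_, secHom_stabLetter_self ε c w⟩
  rw [secHom_stabLetter ε (by rwa [Ne, sub_eq_self]), sub_sub_cancel]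

/-- The elements of a multi-GGS-group whose graft at `vtx c` lies in a given subgroup. -/
def ungraft (c : ZMod p) (M : Subgroup (GGS ε)) : Subgroup (GGS ε) :=
  (M.map (GGS ε).subtype).comap ((graft (vtx c)).comp (GGS ε).subtype)

lemma mem_ungraft {c : ZMod p} {M : Subgroup (GGS ε)} {h : GGS ε} :
    h ∈ ungraft c M ↔ ∃ m ∈ M, (m : AutT p) = graft (vtx c) h := Iff.rfl

lemma ungraft_normal (hnc : NonconstVec ε) (c : ZMod p) (M : Subgroup (GGS ε)) [hM : M.Normal] :
    (ungraft c M).Normal := by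
  constructor
  intro h hh g
  obtain ⟨m, hm, hmh⟩ := mem_ungraft.mp hh
  obtain ⟨s, rfl⟩ := secHom_surjective hnc c g
  refine mem_ungraft.mpr ⟨_, hM.conj_mem m hm s, ?_⟩
  have hs : s.1.1 [] = 1 := s.2
  show s.1.1 * m.1 * s.1.1⁻¹ = _
  rw [hmh, graft_conj, hs]
  rfl

lemma ungraft_le_ungraft (c c' : ZMod p) (M : Subgroup (GGS ε)) [hM : M.Normal] :
    ungraft c M ≤ ungraft c' M := by
  intro h hh
  obtain ⟨m, hm, hmh⟩ := mem_ungraft.mp hh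
  refine mem_ungraft.mpr ⟨_, hM.conj_mem m hm ((selfMarking ε).α (c' - c)), ?_⟩
  show rotA (c' - c) * m.1 * (rotA (c' - c))⁻¹ = _
  rw [hmh, graft_conj, rotA_root, rot_vtx, sections_rotA, add_sub_cancel, one_mul, inv_one,
    mul_one]

lemma commutator_mem_ungraft {d : ZMod p} (hd : d ≠ 0) {w v : V} {u : stabOne ε}
    (hu : secHom ε d u = 1 ∨ coef (ε v) d = 0) :
    ⁅⁅(selfMarking ε).α (coef (ε w) (-d)), (selfMarking ε).β v⁆, secHom ε 0 u⁆ ∈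
      ungraft 0 (gammaThreeStab ε) := by
  refine mem_ungraft.mpr ⟨⁅⁅(selfMarking ε).letter d w, (selfMarking ε).letter 0 v⁆, u.1⁆,
    Subgroup.commutator_mem_commutator (Subgroup.commutator_mem_commutator
      (letter_mem_stabOne ε _ _) (letter_mem_stabOne ε _ _)) u.2, ?_⟩
  have hr : ⁅(ggsMarking ε).letter d w, (ggsMarking ε).letter 0 v⁆ [] = 1 :=
    root_commutator_of_root (ggs_letter_root ε _ _) _
  show ⁅⁅(ggsMarking ε).letter d w, (ggsMarking ε).letter 0 v⁆, u.1.1⁆ =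
    graft (vtx 0) ⁅⁅rotA (coef (ε w) (-d)), directed (ε v)⁆, sections u.1.1 (vtx 0)⁆
  refine ext_portrait (root_commutator_of_root hr _) fun x => ?_
  obtain ⟨c, rfl⟩ := vtx.surjective x
  rw [sections_commutator_of_root hr u.2, sections_commutator_of_root (ggs_letter_root ε _ _)
    (ggs_letter_root ε _ _), sections_ggs_letter, sections_ggs_letter, sections_graft]
  by_cases hc0 : c = 0
  · rw [hc0, if_neg hd, if_pos rfl, if_pos rfl, zero_sub]
  · rw [if_neg (vtx.injective.ne hc0), if_neg (Ne.symm hc0), sub_zero]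
    by_cases hcd : d = c
    · subst hcd
      rw [if_pos rfl]
      rcases hu with hu | hu
      · rw [show sections u.1.1 (vtx d) = 1 from congrArg Subtype.val hu,
          commutatorElement_one_right]
      · rw [hu, rotA_zero, commutatorElement_one_right, commutatorElement_one_left]
    · rw [if_neg hcd, (rotA_commute _ _).commutator_eq, commutatorElement_one_left]

theorem gammaThree_le_ungraft (hp : p ≠ 2) (hnc : NonconstVec ε) (c : ZMod p) :
    gammaThree ε ≤ ungraft c (gammaThreeStab ε) := by
  refine le_trans ?_ (ungraft_le_ungraft 0 c _)
  set A := ungraft 0 (gammaThreeStab ε)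
  have hA : A.Normal := ungraft_normal hnc 0 _
  set E := selfMarking ε
  have key : ∀ g h : GGS ε, ⁅g, h⁆ ∈ A ↔ Commute (g : GGS ε ⧸ A) (h : GGS ε ⧸ A) := fun g h => by
    rw [← commutatorElement_eq_one_iff_commute, ← QuotientGroup.eq_one_iff]
    rfl
  have hcen : ∀ x v g, ⁅⁅E.α x, E.β v⁆, g⁆ ∈ A := by
    intro x v
    let T : Subgroup (GGS ε) := (Subgroup.centralizer
      {((⁅E.α x, E.β v⁆ : GGS ε) : GGS ε ⧸ A)}).comap (QuotientGroup.mk' A)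
    have hT : ∀ g, g ∈ T ↔ ⁅⁅E.α x, E.β v⁆, g⁆ ∈ A := fun g => by
      rw [key, Subgroup.mem_comap, Subgroup.mem_centralizer_singleton_iff]
      exact eq_comm
    have hmem : ∀ d w, d ≠ 0 → coef (ε w) (-d) ≠ 0 → ∀ u : stabOne ε,
        secHom ε d u = 1 ∨ coef (ε v) d = 0 → secHom ε 0 u ∈ T := by
      intro d w hd hw u hu
      rw [hT]
      have h := commutator_mem_ungraft hd (w := (x / coef (ε w) (-d)) • w) hu
      rwa [map_smul, map_smul, Pi.smul_apply, smul_eq_mul, div_mul_cancel₀ x hw] at h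
    have htop : T = ⊤ := by
      refine E.eq_top_of_coef (selfMarking_gen ε) hp hnc (v := v) ?_ ?_ ?_
      · intro d w hd hw x₁ x₂ v₁ v₂ h₁ h₁' h₂ h₂'
        have h := hmem d w hd hw (stabLetter ε x₁ (coef (ε v₂) (d - x₂) • v₁) *
          stabLetter ε x₂ (-coef (ε v₁) (d - x₁) • v₂)) (Or.inl (by
            rw [map_mul, secHom_stabLetter ε h₁', secHom_stabLetter ε h₂', ← Marking.α_add,
              ← E.α_zero]
            congr 1
            simp only [map_smul, Pi.smul_apply, smul_eq_mul]
            ring))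
        rw [map_mul, secHom_stabLetter ε h₁, secHom_stabLetter ε h₂, ← Marking.α_add] at h
        convert h using 2
        simp only [map_smul, Pi.smul_apply, smul_eq_mul, zero_sub]
        ring
      · intro d w hd hw x₁ v₁ v' h₁ h₁' hg
        have h := hmem d w hd hw (stabLetter ε 0 v' *
          stabLetter ε x₁ (-(coef (ε v') d / coef (ε v₁) (d - x₁)) • v₁)) (Or.inl (by
            rw [map_mul, secHom_stabLetter ε hd.symm, secHom_stabLetter ε h₁', ← Marking.α_add,
              ← E.α_zero]
            congr 1
            simp only [map_smul, Pi.smul_apply, smul_eq_mul, sub_zero]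
            field_simp
            ring))
        rw [map_mul, secHom_stabLetter_self, secHom_stabLetter ε h₁, map_smul, map_smul,
          Pi.smul_apply, smul_eq_mul, zero_sub] at h
        exact h
      · intro d w hd hw hv
        rw [eq_top_iff]
        intro g _
        obtain ⟨u, rfl⟩ := secHom_surjective hnc 0 g
        exact hmem d w hd hw u (Or.inr hv)
    intro g
    rw [← hT, htop]
    exact Subgroup.mem_top g
  let Z : Subgroup (GGS ε) := (Subgroup.center (GGS ε ⧸ A)).comap (QuotientGroup.mk' A)
  have hZ : ∀ g, g ∈ Z ↔ ∀ h, ⁅g, h⁆ ∈ A := fun g => by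
    rw [Subgroup.mem_comap, Subgroup.mem_center_iff]
    constructor
    · exact fun h k => (key _ _).mpr (h k).symm
    · intro h k
      obtain ⟨k, rfl⟩ := QuotientGroup.mk'_surjective A k
      exact ((key _ _).mp (h k)).symm
  have hle : ⁅(⊤ : Subgroup (GGS ε)), (⊤ : Subgroup (GGS ε))⁆ ≤ Z := by
    rw [← selfMarking_gen ε, gen]
    apply commutator_closure_le
    have hab : ∀ x v, ⁅E.α x, E.β v⁆ ∈ Z := fun x v => (hZ _).mpr (hcen x v)
    rintro _ (⟨x, rfl⟩ | ⟨v, rfl⟩) _ (⟨y, rfl⟩ | ⟨w, rfl⟩)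
    · rw [commutatorElement_eq_one_iff_mul_comm.mpr]
      · exact one_mem _
      · rw [← Marking.α_add, ← Marking.α_add, add_comm]
    · exact hab x w
    · rw [← commutatorElement_inv]
      exact inv_mem (hab y v)
    · rw [commutatorElement_eq_one_iff_mul_comm.mpr]
      · exact one_mem _
      · rw [← Marking.β_add, ← Marking.β_add, add_comm]
  rw [gammaThree, Subgroup.commutator_le]
  exact fun g hg h _ => (hZ g).mp (hle hg) h

lemma stabIn_le_gammaThree (hε : Function.Injective ε) :
    stabIn (GGS ε) (p + 2) ≤ gammaThree ε := by
  intro g hg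
  obtain ⟨hroot, -⟩ := mem_levelStab_succ.mp (show g.1 ∈ levelStab p (p + 1 + 1) from hg)
  obtain ⟨l, hl⟩ := ggs_eq_ev ε g.2 hroot
  have hg' : g.1 ∈ levelStab p (p + 2) := hg
  rw [hl] at hg'
  rw [show g = (selfMarking ε).ev l from Subtype.ext (hl.trans (coe_selfMarking_ev ε l).symm)]
  exact commutator_stabOne_le ε ((selfMarking ε).ev_mem_commutator (letter_mem_stabOne ε)
    (expSum_eq_zero_of_mem_levelStab hε hg'))

theorem stabIn_le_gammaFour (hp : p ≠ 2) (hnc : NonconstVec ε) (hε : Function.Injective ε) :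
    stabIn (GGS ε) (p + 3) ≤ gammaFour ε := by
  intro g hg
  obtain ⟨hroot, hsec⟩ := mem_levelStab_succ.mp (show g.1 ∈ levelStab p (p + 2 + 1) from hg)
  have h : g.1 ∈ (gammaThreeStab ε).map (GGS ε).subtype := by
    refine mem_of_graft_sections_mem hroot fun x => ?_
    obtain ⟨c, rfl⟩ := vtx.surjective x
    exact gammaThree_le_ungraft hp hnc c (x := ⟨_, selfSimilar_ggs ε _ g.2 (vtx c)⟩)
      (stabIn_le_gammaThree hε (hsec (vtx c)))
  obtain ⟨m, hm, hmg⟩ := h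
  rw [← show m = g from Subtype.ext hmg]
  exact gammaThreeStab_le ε hm

end Branching

section Weakly

open Marking

variable {p : ℕ} [Fact p.Prime] {V : Type*} [AddCommGroup V] [Module (ZMod p) V]
  {ε : V →ₗ[ZMod p] (Fin (p - 1) → ZMod p)}

lemma commutator_secHom_mem_ungraft (hp : p ≠ 2) (hnc : NonconstVec ε) {h : GGS ε}
    (hh : h ∈ gammaThree ε) {L : Subgroup (GGS ε)} {s : stabOne ε} (hs : s.1 ∈ L) :
    ⁅h, secHom ε 0 s⁆ ∈ ungraft 0 ⁅gammaThree ε, L⁆ := by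
  obtain ⟨m, hm, hmh⟩ := mem_ungraft.mp (gammaThree_le_ungraft hp hnc 0 hh)
  have hmK : m ∈ gammaThree ε :=
    commutator_stabOne_le ε (Subgroup.commutator_le_left _ _ hm)
  refine mem_ungraft.mpr ⟨_, Subgroup.commutator_mem_commutator hmK hs, ?_⟩
  show ⁅m.1, s.1.1⁆ = graft (vtx 0) ⁅h.1, sections s.1.1 (vtx 0)⁆
  rw [hmh, graft_commutator s.2]

lemma exists_secHom_eq_of_mem_commutator (hnc : NonconstVec ε) {g : GGS ε}
    (hg : g ∈ ⁅(⊤ : Subgroup (GGS ε)), (⊤ : Subgroup (GGS ε))⁆) :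
    ∃ s : stabOne ε, s.1 ∈ gammaThree ε ∧ secHom ε 0 s = g := by
  have h : (commutator (stabOne ε)).map (secHom ε 0) =
      ⁅(⊤ : Subgroup (GGS ε)), (⊤ : Subgroup (GGS ε))⁆ := by
    rw [commutator_def, Subgroup.map_commutator,
      Subgroup.map_top_of_surjective _ (secHom_surjective hnc 0)]
  rw [← h] at hg
  obtain ⟨s, hs, rfl⟩ := hg
  refine ⟨s, commutator_stabOne_le ε ?_, rfl⟩
  rw [← Subgroup.map_subtype_commutator]
  exact ⟨s, hs, rfl⟩

lemma exists_mem_commutator_secHom_eq (hnc : NonconstVec ε) (g : GGS ε) :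
    ∃ s : stabOne ε, s.1 ∈ ⁅(⊤ : Subgroup (GGS ε)), (⊤ : Subgroup (GGS ε))⁆ ∧
      secHom ε 0 s = g := by
  let R : Subgroup (GGS ε) := (⁅(⊤ : Subgroup (GGS ε)), (⊤ : Subgroup (GGS ε))⁆.comap
    (stabOne ε).subtype).map (secHom ε 0)
  have hR : ∀ x y v, secHom ε 0 (stabLetter ε x v) * (secHom ε 0 (stabLetter ε y v))⁻¹ ∈ R := by
    intro x y v
    refine ⟨stabLetter ε x v * (stabLetter ε y v)⁻¹, ?_, by rw [map_mul, map_inv]⟩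
    show (selfMarking ε).letter x v * ((selfMarking ε).letter y v)⁻¹ ∈
      ⁅(⊤ : Subgroup (GGS ε)), (⊤ : Subgroup (GGS ε))⁆
    rw [letter_eq_commutator_mul, letter_eq_commutator_mul, mul_inv_rev, mul_assoc,
      mul_inv_cancel_left]
    exact mul_mem (Subgroup.commutator_mem_commutator (Subgroup.mem_top _) (Subgroup.mem_top _))
      (inv_mem (Subgroup.commutator_mem_commutator (Subgroup.mem_top _) (Subgroup.mem_top _)))
  have htop : R = ⊤ := by
    obtain ⟨v, c, d, hc, hd, hne⟩ := hnc
    have hα : ∀ x, (selfMarking ε).α x ∈ R := by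
      have h := hR (-c) (-d) v
      rw [secHom_stabLetter ε (neg_ne_zero.mpr hc), secHom_stabLetter ε (neg_ne_zero.mpr hd),
        ← α_neg, ← Marking.α_add, zero_sub, zero_sub, neg_neg, neg_neg] at h
      exact (selfMarking ε).α_mem_of_ne_zero (by rwa [← sub_eq_add_neg, sub_ne_zero]) h
    refine (selfMarking ε).eq_top_of_mem (selfMarking_gen ε) hα fun w => ?_
    have h := hR 0 1 w
    rw [secHom_stabLetter_self, secHom_stabLetter ε one_ne_zero] at h
    exact (Subgroup.mul_mem_cancel_right _ (inv_mem (hα _))).mp h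
  obtain ⟨s, hs, hsg⟩ : g ∈ R := htop ▸ Subgroup.mem_top g
  exact ⟨s, hs, hsg⟩

lemma ungraft_mono (c : ZMod p) {M N : Subgroup (GGS ε)} (h : M ≤ N) : ungraft c M ≤ ungraft c N :=
  Subgroup.comap_mono (Subgroup.map_mono h)

theorem gammaFour_le_ungraft_ungraft (hp : p ≠ 2) (hnc : NonconstVec ε) :
    gammaFour ε ≤ ungraft 0 (ungraft 0 ⁅gammaThree ε, gammaThree ε⁆) := by
  rw [gammaFour, Subgroup.commutator_le]
  intro h hh g _
  obtain ⟨s, hs, rfl⟩ := exists_mem_commutator_secHom_eq hnc g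
  refine ungraft_mono 0 ?_ (commutator_secHom_mem_ungraft hp hnc hh hs)
  rw [Subgroup.commutator_le]
  intro h hh g hg
  obtain ⟨s, hs, rfl⟩ := exists_secHom_eq_of_mem_commutator hnc hg
  exact commutator_secHom_mem_ungraft hp hnc hh hs

/-- A multi-GGS-group acts transitively on the levels of the tree. -/
lemma exists_act_eq (hnc : NonconstVec ε) : ∀ u v : List (Fin p), u.length = v.length →
    ∃ g : GGS ε, act g.1 u = v
  | [], [], _ => ⟨1, rfl⟩
  | x :: u, y :: v, h => by
    obtain ⟨c, rfl⟩ := vtx.surjective x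
    obtain ⟨d, rfl⟩ := vtx.surjective y
    obtain ⟨g, hg⟩ := exists_act_eq hnc u v (Nat.succ_injective h)
    obtain ⟨s, rfl⟩ := secHom_surjective hnc c g
    refine ⟨(selfMarking ε).α (d - c) * s, ?_⟩
    show act (rotA (d - c) * s.1.1) _ = _
    have hs : s.1.1 [] = 1 := s.2
    rw [act_mul, act_cons, hs, Equiv.Perm.one_apply, act_cons, rotA_root, rot_vtx,
      sections_rotA, act_one, add_sub_cancel]
    exact congrArg _ hg

lemma infinite_ggs (hnc : NonconstVec ε) : Infinite (GGS ε) := by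
  by_contra hfin
  rw [not_infinite_iff_finite] at hfin
  have hle := Nat.card_le_card_of_surjective _ (secHom_surjective hnc 0)
  have htop := Subgroup.eq_top_of_le_card _ hle
  have h : (selfMarking ε).α 1 ∈ stabOne ε := htop ▸ Subgroup.mem_top _
  exact one_ne_zero (rot_eq_one_iff.mp h)

lemma mem_of_graftWord_mem {M : Subgroup (AutT p)} (n m : ℕ)
    (h : ∀ v : List (Fin p), v.length = n → ∀ f ∈ GGS ε, f ∈ levelStab p m → graftWord v f ∈ M)
    {f : AutT p} (hf : f ∈ GGS ε) (hfm : f ∈ levelStab p (m + n)) : f ∈ M := by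
  induction n generalizing M f with
  | zero => exact h [] rfl f hf hfm
  | succ n ih =>
    obtain ⟨hroot, hsec⟩ := mem_levelStab_succ.mp (show f ∈ levelStab p (m + n + 1) from hfm)
    refine mem_of_graft_sections_mem hroot fun x => ?_
    exact ih (M := M.comap (graft x)) (fun v hv g hg hgm => h (x :: v) (by simp [hv]) g hg hgm)
      (selfSimilar_ggs ε f hf x) (hsec x)

theorem exists_stabIn_le (hp : p ≠ 2) (hnc : NonconstVec ε) (hε : Function.Injective ε)
    {N : Subgroup (GGS ε)} (hN : N.Normal) (hne : N ≠ ⊥) : ∃ n, stabIn (GGS ε) n ≤ N := by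
  obtain ⟨g, hgN, hg1⟩ := N.bot_or_exists_ne_one.resolve_left hne
  obtain ⟨u, hu⟩ := exists_act_ne (g := g.1) fun h => hg1 (Subtype.ext h)
  let M := N.map (GGS ε).subtype
  have hMN : ∀ {f : GGS ε}, f.1 ∈ M ↔ f ∈ N := fun {f} =>
    Subgroup.mem_map_iff_mem (GGS ε).subtype_injective
  have hgraft : ∀ (u : List (Fin p)), ∀ h ∈ gammaThree ε, graftWord u h.1 ∈
      (gammaThree ε).map (GGS ε).subtype := by
    intro u
    induction u with
    | nil => exact fun h hh => ⟨h, hh, rfl⟩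
    | cons x u ih =>
      intro h hh
      obtain ⟨m, hm, hmh⟩ := ih h hh
      obtain ⟨c, rfl⟩ := vtx.surjective x
      obtain ⟨k, hk, hkm⟩ := mem_ungraft.mp (gammaThree_le_ungraft hp hnc c hm)
      refine ⟨k, commutator_stabOne_le ε (Subgroup.commutator_le_left _ _ hk), ?_⟩
      rw [graftWord_cons, ← hmh]
      exact hkm
  have hcomm : ∀ f ∈ ⁅gammaThree ε, gammaThree ε⁆, graftWord u f.1 ∈ M := by
    show ⁅gammaThree ε, gammaThree ε⁆ ≤ M.comap ((graftWord u).comp (GGS ε).subtype)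
    rw [Subgroup.commutator_le]
    intro h hh k hk
    obtain ⟨h', -, hh'⟩ := hgraft u h hh
    obtain ⟨k', -, hk'⟩ := hgraft u k hk
    have hmem : ⁅⁅h', g⁆, k'⁆ ∈ N := by
      have h1 : ⁅h', g⁆ ∈ N := (Subgroup.commutator_le_right ⊤ N)
        (Subgroup.commutator_mem_commutator (Subgroup.mem_top _) hgN)
      exact (Subgroup.commutator_le_left N ⊤)
        (Subgroup.commutator_mem_commutator h1 (Subgroup.mem_top _))
    obtain ⟨s, -, hs⟩ := (selfSimilar_ggs ε).graftWord_conj u g.2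
    have heq : ⁅⁅graftWord u h.1, g.1⁆, graftWord u k.1⁆ = graftWord u ⁅h.1, k.1⁆ := by
      have h1 : ⁅graftWord u h.1, g.1⁆ =
          graftWord u h.1 * graftWord (act g.1 u) (s * h.1⁻¹ * s⁻¹) := by
        rw [← hs, commutatorElement_def, map_inv]
        group
      have h2 := commute_graftWord (act_length g.1 u) hu (s * h.1⁻¹ * s⁻¹) k.1
      rw [h1, map_commutatorElement, commutatorElement_def, commutatorElement_def, mul_inv_rev,
        mul_assoc (graftWord u h.1), h2.eq, ← mul_assoc, ← mul_assoc, mul_inv_cancel_right]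
    show graftWord u ⁅h.1, k.1⁆ ∈ M
    rw [← heq, ← hh', ← hk']
    exact ⟨_, hmem, rfl⟩
  have hall : ∀ v : List (Fin p), v.length = (u ++ [vtx 0, vtx 0]).length →
      ∀ h ∈ gammaFour ε, graftWord v h.1 ∈ M := by
    intro v hv h hh
    obtain ⟨t, rfl⟩ := exists_act_eq hnc _ v hv.symm
    obtain ⟨s, hs, hconj⟩ := (selfSimilar_ggs ε).graftWord_conj (u ++ [vtx 0, vtx 0]) t.2
    let s' : GGS ε := ⟨s, hs⟩
    have hh' : s'⁻¹ * h * s' ∈ gammaFour ε := by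
      simpa using (inferInstance : (gammaFour ε).Normal).conj_mem h hh s'⁻¹
    obtain ⟨m₁, hm₁, e₁⟩ := mem_ungraft.mp (gammaFour_le_ungraft_ungraft hp hnc hh')
    obtain ⟨m₂, hm₂, e₂⟩ := mem_ungraft.mp hm₁
    obtain ⟨m, hm, e⟩ := hcomm m₂ hm₂
    refine ⟨_, hN.conj_mem m hm t, ?_⟩
    have e' : m.1 = graftWord (u ++ [vtx 0, vtx 0]) (s'⁻¹ * h * s' : GGS ε).1 := by
      rw [graftWord_append]
      refine e.trans ?_
      rw [e₂, e₁]
      rfl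
    show t.1 * m.1 * t.1⁻¹ = _
    rw [e', hconj]
    congr 1
    show s * (s⁻¹ * h.1 * s) * s⁻¹ = h.1
    group
  refine ⟨p + 3 + (u ++ [vtx 0, vtx 0]).length, fun f hf =>
    hMN.mp (mem_of_graftWord_mem _ (p + 3) (fun v hv k hk hkm => ?_) f.2 hf)⟩
  exact hall v hv ⟨k, hk⟩ (stabIn_le_gammaFour hp hnc hε hkm)

instance stabIn_finiteIndex (G : Subgroup (AutT p)) (n : ℕ) : (stabIn G n).FiniteIndex :=
  inferInstanceAs ((levelStab p n).subgroupOf G).FiniteIndex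

theorem justInfinite_ggs (hp : p ≠ 2) (hnc : NonconstVec ε) (hε : Function.Injective ε) :
    JustInfinite (GGS ε) := by
  refine ⟨infinite_ggs hnc, fun N hN hne => ?_⟩
  obtain ⟨n, hn⟩ := exists_stabIn_le hp hnc hε hN hne
  exact Subgroup.finiteIndex_of_le hn

theorem hasCSP_ggs (hp : p ≠ 2) (hnc : NonconstVec ε) (hε : Function.Injective ε) :
    HasCSP (GGS ε) := by
  intro H hH
  have hne : H.normalCore ≠ ⊥ := by
    intro h
    have hfin : (⊥ : Subgroup (GGS ε)).FiniteIndex := h ▸ inferInstance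
    have := infinite_ggs hnc
    exact hfin.index_ne_zero (by rw [Subgroup.index_bot, Nat.card_eq_zero_of_infinite])
  obtain ⟨n, hn⟩ := exists_stabIn_le hp hnc hε H.normalCore_normal hne
  exact ⟨n, hn.trans H.normalCore_le⟩

end Weakly

section MultiGGS

open Marking

variable {p : ℕ} [Fact p.Prime]

lemma multiGGS_eq_ggs {r : ℕ} (e : Fin r → Fin (p - 1) → ZMod p) :
    multiGGS p e = GGS (Fintype.linearCombination (ZMod p) e) := by
  set ε := Fintype.linearCombination (ZMod p) e
  have he : ∀ i, (ggsMarking ε).β (Pi.single i 1) = directed (e i) := fun i => by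
    show directed (ε _) = _
    rw [Fintype.linearCombination_apply_single, one_smul]
  apply le_antisymm
  · rw [multiGGS, Subgroup.closure_le]
    rintro _ (rfl | ⟨i, rfl⟩)
    · exact rotA_one (p := p) ▸ (ggsMarking ε).α_mem 1
    · show directed (e i) ∈ GGS ε
      rw [← he i]
      exact (ggsMarking ε).β_mem _
  · rw [GGS, gen, Subgroup.closure_le]
    rintro _ (⟨x, rfl⟩ | ⟨v, rfl⟩)
    · rw [← mul_one x]
      exact α_smul_mem (ggsMarking ε) (Subgroup.subset_closure (Or.inl rotA_one)) x
    · rw [← Finset.univ_sum_single v]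
      refine Finset.sum_induction _ (fun v => (ggsMarking ε).β v ∈ multiGGS p e) ?_ ?_ ?_
      · exact fun v w hv hw => (ggsMarking ε).β_add v w ▸ mul_mem hv hw
      · exact (ggsMarking ε).β_zero ▸ one_mem _
      · intro i _
        have h := β_smul_mem (ggsMarking ε) (K := multiGGS p e) (v := Pi.single i 1)
          (he i ▸ Subgroup.subset_closure (Or.inr ⟨i, rfl⟩)) (v i)
        rwa [← Pi.single_smul, smul_eq_mul, mul_one] at h

lemma ggs_eq_of_range_eq {V W : Type*} [AddCommGroup V] [Module (ZMod p) V] [AddCommGroup W]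
    [Module (ZMod p) W] {ε : V →ₗ[ZMod p] (Fin (p - 1) → ZMod p)}
    {ε' : W →ₗ[ZMod p] (Fin (p - 1) → ZMod p)} (h : Set.range ε = Set.range ε') :
    GGS ε = GGS ε' := by
  have hβ : Set.range (ggsMarking ε).β = Set.range (ggsMarking ε').β :=
    (Set.range_comp directed ε).trans ((congrArg _ h).trans (Set.range_comp directed ε').symm)
  rw [GGS, gen, hβ]
  rfl

lemma isConstGGS_of_not_nonconstVec {V : Type*} [AddCommGroup V] [Module (ZMod p) V]
    {ε : V →ₗ[ZMod p] (Fin (p - 1) → ZMod p)} (h0 : ε ≠ 0) (h : ¬ NonconstVec ε) :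
    IsConstGGS (GGS ε) := by
  have hconst : ∀ v, ε v = constVec p (coef (ε v) 1) := by
    intro v
    apply coef_injective
    funext c
    by_cases hc : c = 0
    · rw [hc, coef_zero, coef_zero]
    · rw [coef_constVec p _ hc]
      by_contra hne
      exact h ⟨v, c, 1, hc, one_ne_zero, hne⟩
  obtain ⟨v, hv⟩ := DFunLike.ne_iff.mp h0
  have hc : coef (ε v) 1 ≠ 0 := by
    intro hc
    rw [hconst v, hc, map_zero] at hv
    exact hv rfl
  refine ⟨_, hc, ?_⟩
  rw [← ggs_constVec p hc]
  apply ggs_eq_of_range_eq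
  apply subset_antisymm
  · rintro _ ⟨w, rfl⟩
    exact ⟨_, (hconst w).symm⟩
  · rintro _ ⟨k, rfl⟩
    refine ⟨(k / coef (ε v) 1) • v, ?_⟩
    rw [map_smul]
    refine (congrArg (fun f => (k / coef (ε v) 1) • f) (hconst v)).trans ?_
    show (k / coef (ε v) 1) • constVec p (coef (ε v) 1) = constVec p k
    rw [← map_smul, smul_eq_mul, div_mul_cancel₀ k hc]

end MultiGGS

end AutT

end TreeAut

open TreeAut AutT Subgroup

/-- A multi-GGS-group `G` is just infinite and has the congruence subgroup
property if and only if `G` is not the GGS-group `𝒢` defined by a constant vector. -/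
theorem multiGGS_justInfinite_and_hasCSP_iff_not_constGGS
    (p r : ℕ) (hp : p.Prime) (hpodd : Odd p) (hr : 1 ≤ r)
    (e : Fin r → Fin (p - 1) → ZMod p) (he : LinearIndependent (ZMod p) e) :
    (JustInfinite (multiGGS p e) ∧ HasCSP (multiGGS p e)) ↔ ¬ IsConstGGS (multiGGS p e) := by
  have : Fact p.Prime := ⟨hp⟩
  have hp2 : p ≠ 2 := by
    rintro rfl
    exact absurd hpodd (by decide)
  have hε : Function.Injective (Fintype.linearCombination (ZMod p) e) :=
    linearIndependent_iff_injective_fintypeLinearCombination.mp he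
  constructor
  · rintro ⟨hJ, -⟩ ⟨c, hc, h⟩
    rw [h, ← ggs_constVec p hc] at hJ
    exact not_justInfinite_ggs_constVec p hp2 hJ
  · intro h
    rw [multiGGS_eq_ggs] at h ⊢
    have hnc : NonconstVec (Fintype.linearCombination (ZMod p) e) := by
      by_contra hnc
      refine h (isConstGGS_of_not_nonconstVec (fun h0 => ?_) hnc)
      refine he.ne_zero ⟨0, hr⟩ ?_
      have h1 := DFunLike.congr_fun h0 (Pi.single ⟨0, hr⟩ 1)
      rwa [Fintype.linearCombination_apply_single, one_smul] at h1
    exact ⟨justInfinite_ggs hp2 hnc hε, hasCSP_ggs hp2 hnc hε⟩
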